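/- arXiv:math/0509277 — 2 statements merged into one kernel-verified Lean document; each statement's English description precedes it below -/
import Mathlib

section
/- Let f : A ⊆ ℝ^k → ℝ^l be a semi-algebraic map. Then its domain A is a semi-algebraic set, and deg(A) is bounded by a function of deg(f), k and l only. -/
open Set

noncomputable section

/-- The open unit cube `(0,1)^d`. -/
def cubeO (d : ℕ) : Set (Fin d → ℝ) := {x | ∀ i, x i ∈ Set.Ioo (0:ℝ) 1}

/-- The closed unit cube `[0,1]^d`. -/
def cubeC (d : ℕ) : Set (Fin d → ℝ) := {x | ∀ i, x i ∈ Set.Icc (0:ℝ) 1}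

/-- A presentation of a semi-algebraic set: a finite union (list) of conjunctions, each
given by a list of polynomials required to be `> 0` and a list required to be `= 0`. -/
abbrev SAPres (d : ℕ) :=
  List (List (MvPolynomial (Fin d) ℝ) × List (MvPolynomial (Fin d) ℝ))

/-- The set defined by a presentation. -/
def SAPres.toSet {d : ℕ} (p : SAPres d) : Set (Fin d → ℝ) :=
  {x | ∃ c ∈ p, (∀ P ∈ c.1, 0 < MvPolynomial.eval x P) ∧
                (∀ P ∈ c.2, MvPolynomial.eval x P = 0)}

/-- The degree of a presentation: the sum of the total degrees of the polynomials
involved (with multiplicities). -/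
def SAPres.deg {d : ℕ} (p : SAPres d) : ℕ :=
  (p.map fun c =>
    (c.1.map MvPolynomial.totalDegree).sum + (c.2.map MvPolynomial.totalDegree).sum).sum

/-- A set is semi-algebraic if it admits a presentation. -/
def IsSemialgebraic {d : ℕ} (A : Set (Fin d → ℝ)) : Prop := ∃ p : SAPres d, p.toSet = A

/-- The degree of a semi-algebraic set: the minimum degree of its presentations. -/
def SADeg {d : ℕ} (A : Set (Fin d → ℝ)) : ℕ :=
  sInf (SAPres.deg '' {p : SAPres d | p.toSet = A})

/-- The graph of `f : A → ℝ^n`, `A ⊆ ℝ^k`, as a subset of `ℝ^(k+n)`. -/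
def graphSet {k n : ℕ} (A : Set (Fin k → ℝ)) (f : (Fin k → ℝ) → (Fin n → ℝ)) :
    Set (Fin (k + n) → ℝ) :=
  {z | (fun i => z (Fin.castAdd n i)) ∈ A ∧
       (fun j => z (Fin.natAdd k j)) = f fun i => z (Fin.castAdd n i)}

/-- A map is semi-algebraic if its graph is a semi-algebraic set. -/
def IsSAMap {k n : ℕ} (A : Set (Fin k → ℝ)) (f : (Fin k → ℝ) → (Fin n → ℝ)) : Prop :=
  IsSemialgebraic (graphSet A f)

/-- The degree of a semi-algebraic map is the degree of its graph. -/
def SAMapDeg {k n : ℕ} (A : Set (Fin k → ℝ)) (f : (Fin k → ℝ) → (Fin n → ℝ)) : ℕ :=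
  SADeg (graphSet A f)

/-- Scalar-valued version of `IsSAMap`. -/
def IsSAFun {k : ℕ} (A : Set (Fin k → ℝ)) (f : (Fin k → ℝ) → ℝ) : Prop :=
  IsSAMap A fun x (_ : Fin 1) => f x

/-- Scalar-valued version of `SAMapDeg`. -/
def SAFunDeg {k : ℕ} (A : Set (Fin k → ℝ)) (f : (Fin k → ℝ) → ℝ) : ℕ :=
  SAMapDeg A fun x (_ : Fin 1) => f x

/-- `A ⊆ ℝ^d` is an `m`-dimensional analytic submanifold: around each of its points there is
an analytic chart of `ℝ^d` straightening `A` to a coordinate subspace of dimension `m`. -/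
def IsAnalyticSubmanifold {d : ℕ} (A : Set (Fin d → ℝ)) (m : ℕ) : Prop :=
  ∀ x ∈ A, ∃ (U V : Set (Fin d → ℝ)) (φ ψ : (Fin d → ℝ) → (Fin d → ℝ)),
    IsOpen U ∧ IsOpen V ∧ x ∈ U ∧
    AnalyticOnNhd ℝ φ U ∧ AnalyticOnNhd ℝ ψ V ∧
    (∀ y ∈ U, φ y ∈ V) ∧ (∀ z ∈ V, ψ z ∈ U) ∧
    (∀ y ∈ U, ψ (φ y) = y) ∧ (∀ z ∈ V, φ (ψ z) = z) ∧
    φ '' (U ∩ A) = V ∩ {z | ∀ i : Fin d, m ≤ (i : ℕ) → z i = 0}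

/-- A Nash manifold: an analytic submanifold of `ℝ^d` which is a semi-algebraic set. -/
def IsNashManifold {d : ℕ} (A : Set (Fin d → ℝ)) (m : ℕ) : Prop :=
  IsSemialgebraic A ∧ IsAnalyticSubmanifold A m

/-- A Nash map on `A`: a semi-algebraic map which is analytic on `A` (i.e. extends
analytically around every point of `A`). -/
def IsNashMap {k n : ℕ} (A : Set (Fin k → ℝ)) (f : (Fin k → ℝ) → (Fin n → ℝ)) : Prop :=
  IsSAMap A f ∧ ∀ x ∈ A, ∃ (U : Set (Fin k → ℝ)) (g : (Fin k → ℝ) → (Fin n → ℝ)),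
    IsOpen U ∧ x ∈ U ∧ AnalyticOnNhd ℝ g U ∧ Set.EqOn f g (A ∩ U)

/-- Scalar valued Nash map. -/
def IsNashFun {k : ℕ} (A : Set (Fin k → ℝ)) (f : (Fin k → ℝ) → ℝ) : Prop :=
  IsSAFun A f ∧ ∀ x ∈ A, ∃ (U : Set (Fin k → ℝ)) (g : (Fin k → ℝ) → ℝ),
    IsOpen U ∧ x ∈ U ∧ AnalyticOnNhd ℝ g U ∧ Set.EqOn f g (A ∩ U)

/-- The total degree `|α|` of a multi-index. -/
def mIdxDeg {d : ℕ} (α : Fin d → ℕ) : ℕ := ∑ i, α i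

/-- The total order `≼` on multi-indices: `α ≼ β` iff `|α| < |β|`, or `|α| = |β|` and
`α k ≤ β k` at the largest index `k` where they differ (reflexivity included). -/
def mIdxLE {d : ℕ} (α β : Fin d → ℕ) : Prop :=
  α = β ∨ mIdxDeg α < mIdxDeg β ∨
    (mIdxDeg α = mIdxDeg β ∧ ∃ k, α k < β k ∧ ∀ l, k < l → α l = β l)

/-- Pad a multi-index on `Fin l` to one on `Fin d` by zeros (in the last coordinates). -/
def padIdx {l d : ℕ} (β : Fin l → ℕ) : Fin d → ℕ :=
  fun i => if h : (i : ℕ) < l then β ⟨i, h⟩ else 0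

/-- First-order partial derivative in the `i`-th coordinate direction. -/
def pderiv1 {d : ℕ} (i : Fin d) (f : (Fin d → ℝ) → ℝ) : (Fin d → ℝ) → ℝ :=
  fun x => fderiv ℝ f x (Pi.single i 1)

/-- Iterated partial derivative `∂^β f` associated to a multi-index `β`. -/
def mpderiv {d : ℕ} (β : Fin d → ℕ) (f : (Fin d → ℝ) → ℝ) : (Fin d → ℝ) → ℝ :=
  (List.finRange d).foldl (fun g i => (pderiv1 i)^[β i] g) f

/-- A `C⁰`-Nash map `A → (0,1)^n`: a Nash map with values in the open unit cube which
extends continuously to the closure of `A`. -/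
def IsC0NashMap {k n : ℕ} (A : Set (Fin k → ℝ)) (f : (Fin k → ℝ) → (Fin n → ℝ)) : Prop :=
  IsNashMap A f ∧ (∀ x ∈ A, f x ∈ cubeO n) ∧
    ∃ g : (Fin k → ℝ) → (Fin n → ℝ), ContinuousOn g (closure A) ∧ Set.EqOn f g A

/-- Scalar version of `IsC0NashMap`, with values in `(0,1)`. -/
def IsC0NashFun {k : ℕ} (A : Set (Fin k → ℝ)) (f : (Fin k → ℝ) → ℝ) : Prop :=
  IsNashFun A f ∧ (∀ x ∈ A, f x ∈ Set.Ioo (0:ℝ) 1) ∧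
    ∃ g : (Fin k → ℝ) → ℝ, ContinuousOn g (closure A) ∧ Set.EqOn f g A

/-- The bound `‖f‖_α ≤ K`: all partial derivatives `∂^β f` with `β ≼ α` are bounded by `K`
on `A`.  (Multi-indices `β` on the domain are padded by zeros to be compared with `α`.) -/
def CalphaBound {k e : ℕ} (A : Set (Fin k → ℝ)) (α : Fin e → ℕ) (K : ℝ)
    (f : (Fin k → ℝ) → ℝ) : Prop :=
  ∀ β : Fin k → ℕ, mIdxLE (padIdx β) α → ∀ x ∈ A, |mpderiv β f x| ≤ K

/-- A `(C^α,K)`-Nash map: a `C⁰`-Nash map with `‖f‖_α ≤ K`. -/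
def IsCalphaNashMap {k n e : ℕ} (A : Set (Fin k → ℝ)) (α : Fin e → ℕ) (K : ℝ)
    (f : (Fin k → ℝ) → (Fin n → ℝ)) : Prop :=
  IsC0NashMap A f ∧ ∀ j : Fin n, CalphaBound A α K fun x => f x j

/-- Scalar version of `IsCalphaNashMap`. -/
def IsCalphaNashFun {k e : ℕ} (A : Set (Fin k → ℝ)) (α : Fin e → ℕ) (K : ℝ)
    (f : (Fin k → ℝ) → ℝ) : Prop :=
  IsC0NashFun A f ∧ CalphaBound A α K f

/-- A `(C^r,K)`-Nash map: a `C⁰`-Nash map all of whose partial derivatives of order `≤ r`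
are bounded by `K`. -/
def IsCrNashMap {k n : ℕ} (A : Set (Fin k → ℝ)) (r : ℕ) (K : ℝ)
    (f : (Fin k → ℝ) → (Fin n → ℝ)) : Prop :=
  IsC0NashMap A f ∧ ∀ (j : Fin n) (β : Fin k → ℕ), mIdxDeg β ≤ r →
    ∀ x ∈ A, |mpderiv β (fun y => f y j) x| ≤ K

/-- A triangular map `(0,1)^l → (0,1)^d`: the `(d-l+k)`-th coordinate depends only on the
variables `x_k, …, x_l` (stated here with `0`-based indices). -/
def IsTriangular {l d : ℕ} (ψ : (Fin l → ℝ) → (Fin d → ℝ)) : Prop :=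
  l ≤ d ∧ ∀ (j : Fin d) (x y : Fin l → ℝ),
    (∀ i : Fin l, (j : ℕ) ≤ (i : ℕ) + (d - l) → x i = y i) → ψ x j = ψ y j

/-- `A` has maximum dimension `l`: it admits a finite partition into connected Nash
manifolds of dimensions `≤ l`, with `l` attained. -/
def HasMaxDim {d : ℕ} (A : Set (Fin d → ℝ)) (l : ℕ) : Prop :=
  ∃ (N : ℕ) (S : Fin N → Set (Fin d → ℝ)) (m : Fin N → ℕ),
    (∀ i, IsNashManifold (S i) (m i)) ∧ (∀ i, IsConnected (S i)) ∧
    A = (⋃ i, S i) ∧ (∀ i j, i ≠ j → Disjoint (S i) (S j)) ∧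
    (∀ i, m i ≤ l) ∧ (∃ i, m i = l)

/-- A `(C^α,K)`-resolution, with all cardinality/degree bounds at most `B`, of a finite
family of maps `f j : A → (0,1)`, where `A ⊆ (0,1)^d` has maximum dimension `l`. -/
def HasFamilyResolution {d k : ℕ} (l : ℕ) (A : Set (Fin d → ℝ))
    (f : Fin k → (Fin d → ℝ) → ℝ) (α : Fin d → ℕ) (K B : ℝ) : Prop :=
  ∃ (N : ℕ) (φ : Fin N → (Fin l → ℝ) → (Fin d → ℝ)),
    (∀ i, IsTriangular (φ i)) ∧
    (∀ i, IsCalphaNashMap (cubeO l) α K (φ i)) ∧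
    (∀ i j, IsCalphaNashFun (cubeO l) α K fun x => f j (φ i x)) ∧
    closure A = (⋃ i, φ i '' cubeC l) ∧
    (N : ℝ) ≤ B ∧
    (∀ i, (SAMapDeg (cubeO l) (φ i) : ℝ) ≤ B) ∧
    (∀ i j, (SAFunDeg (cubeO l) (fun x => f j (φ i x)) : ℝ) ≤ B)

/-- The open slice `{(x₁,y) ∈ (0,1) × S : f y < x₁ < g y}` in `ℝ^(d+1)`. -/
def bandSlice {d : ℕ} (S : Set (Fin d → ℝ)) (f g : (Fin d → ℝ) → ℝ) :
    Set (Fin (d+1) → ℝ) :=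
  {z | z 0 ∈ Set.Ioo (0:ℝ) 1 ∧ Fin.tail z ∈ S ∧ f (Fin.tail z) < z 0 ∧ z 0 < g (Fin.tail z)}

/-- The graph slice `{(f y, y) : y ∈ S}` in `ℝ^(d+1)`. -/
def graphSlice {d : ℕ} (S : Set (Fin d → ℝ)) (f : (Fin d → ℝ) → ℝ) :
    Set (Fin (d+1) → ℝ) :=
  {z | Fin.tail z ∈ S ∧ z 0 = f (Fin.tail z)}

/-- The Euclidean distance from a point to a set. -/
def eDist {d : ℕ} (x : Fin d → ℝ) (S : Set (Fin d → ℝ)) : ℝ :=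
  sInf ((fun y => Real.sqrt (∑ i, (x i - y i) ^ 2)) '' S)

end

/-- The local sign coefficient of `h` at `x`: the value at `x` of `h` stripped of all its
factors `X - x`. -/
noncomputable def localCoeff (x : ℝ) (h : Polynomial ℝ) : ℝ :=
  (h /ₘ (Polynomial.X - Polynomial.C x) ^ h.rootMultiplicity x).eval x

/-- Half the jump of the sign of `h` when its argument crosses `x`. -/
noncomputable def signJump (x : ℝ) (h : Polynomial ℝ) : ℤ :=
  if Odd (h.rootMultiplicity x) then SignType.sign (localCoeff x h) else 0

open Classical in
/-- The Cauchy index of the rational function `q / p` over the real line. -/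
noncomputable def cauchyIndex (p q : Polynomial ℝ) : ℤ :=
  ∑ x ∈ p.roots.toFinset,
    if q.rootMultiplicity x < p.rootMultiplicity x then signJump x (p * q) else 0

section CauchyIndex

open Polynomial

theorem exists_eq_pow_mul_eval_ne_zero {h : ℝ[X]} (h0 : h ≠ 0) (x : ℝ) :
    ∃ n : ℕ, ∃ g : ℝ[X], g.eval x ≠ 0 ∧ h = (X - C x) ^ n * g := by
  obtain ⟨g, hg, hd⟩ := exists_eq_pow_rootMultiplicity_mul_and_not_dvd h h0 x
  exact ⟨_, g, fun hx => hd (dvd_iff_isRoot.2 hx), hg⟩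

theorem rootMultiplicity_pow_mul {x : ℝ} {g : ℝ[X]} (hg : g.eval x ≠ 0) (n : ℕ) :
    ((X - C x) ^ n * g).rootMultiplicity x = n := by
  rw [mul_comm, rootMultiplicity_mul_X_sub_C_pow (by rintro rfl; simp at hg),
    rootMultiplicity_eq_zero hg, zero_add]

theorem localCoeff_pow_mul {x : ℝ} {g : ℝ[X]} (hg : g.eval x ≠ 0) (n : ℕ) :
    localCoeff x ((X - C x) ^ n * g) = g.eval x := by
  rw [localCoeff, rootMultiplicity_pow_mul hg,
    mul_divByMonic_cancel_left _ ((monic_X_sub_C x).pow n)]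

theorem signJump_pow_mul {x : ℝ} {g : ℝ[X]} (hg : g.eval x ≠ 0) (n : ℕ) :
    signJump x ((X - C x) ^ n * g) = if Odd n then (SignType.sign (g.eval x) : ℤ) else 0 := by
  rw [signJump, rootMultiplicity_pow_mul hg, localCoeff_pow_mul hg]

theorem signJump_zero (x : ℝ) : signJump x 0 = 0 := by
  simp [signJump]

theorem signJump_of_eval_ne_zero {x : ℝ} {h : ℝ[X]} (hx : h.eval x ≠ 0) : signJump x h = 0 := by
  simp [signJump, rootMultiplicity_eq_zero hx]

theorem sign_eval_of_roots_lt {g : ℝ[X]} {x : ℝ} (hroots : ∀ y, g.IsRoot y → y < x) :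
    SignType.sign (g.eval x) = SignType.sign g.leadingCoeff := by
  rcases lt_trichotomy g.leadingCoeff 0 with h | h | h
  · rw [sign_neg h, sign_neg (eval_lt_zero_of_roots_lt_of_leadingCoeff_nonpos hroots h.le)]
  · have : g = 0 := leadingCoeff_eq_zero.1 h
    simp [this]
  · rw [sign_pos h, sign_pos (zero_lt_eval_of_roots_lt_of_leadingCoeff_nonneg hroots h.le)]

theorem even_natDegree_of_no_roots {g : ℝ[X]} (hg : ∀ y, ¬ g.IsRoot y) : Even g.natDegree := by
  by_contra hodd
  rw [Nat.not_even_iff_odd] at hodd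
  have key : ∀ f : ℝ[X], (∀ y, ¬ f.IsRoot y) → Odd f.natDegree → 0 ≤ f.leadingCoeff → False := by
    intro f hf ho hl
    have h1 := zero_lt_eval_of_roots_lt_of_leadingCoeff_nonneg (x := 0)
      (fun y hy => (hf y hy).elim) hl
    have h2 := zero_lt_negOnePow_mul_eval_of_lt_roots_of_leadingCoeff_nonneg (x := 0)
      (fun y hy => (hf y hy).elim) hl
    rw [Int.negOnePow_odd _ (by exact_mod_cast ho)] at h2
    push_cast at h2
    linarith
  rcases le_total 0 g.leadingCoeff with h | h
  · exact key g hg hodd h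
  · exact key (-g) (fun y hy => hg y (by simpa [IsRoot] using hy)) (by simpa using hodd)
      (by simpa using h)

theorem signJump_X_sub_C_mul_of_lt {x a : ℝ} (hx : x < a) (g : ℝ[X]) :
    signJump x ((X - C a) * g) = - signJump x g := by
  rcases eq_or_ne g 0 with rfl | hg
  · simp [signJump_zero]
  obtain ⟨n, u, hu, rfl⟩ := exists_eq_pow_mul_eval_ne_zero hg x
  rw [show (X - C a) * ((X - C x) ^ n * u) = (X - C x) ^ n * ((X - C a) * u) by ring,
    signJump_pow_mul hu, signJump_pow_mul]
  · rw [eval_mul, sign_mul]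
    have : SignType.sign ((X - C a).eval x) = -1 := by simp [hx]
    rw [this]
    split_ifs <;> simp
  · rw [eval_mul]
    exact mul_ne_zero (by simp [sub_eq_zero, hx.ne]) hu

theorem signJump_X_sub_C_mul_self {a : ℝ} {g : ℝ[X]} (hg : g ≠ 0)
    (hroots : ∀ y, g.IsRoot y → y ≤ a) :
    signJump a ((X - C a) * g) + signJump a g = SignType.sign g.leadingCoeff := by
  obtain ⟨n, u, hu, rfl⟩ := exists_eq_pow_mul_eval_ne_zero hg a
  rw [← mul_assoc, ← pow_succ', signJump_pow_mul hu, signJump_pow_mul hu,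
    sign_eval_of_roots_lt (g := u), leadingCoeff_monic_mul ((monic_X_sub_C a).pow n)]
  · by_cases h : Odd n
    · simp [h, Nat.odd_add_one]
    · simp [h, Nat.odd_add_one]
  · intro y hy
    refine lt_of_le_of_ne (hroots y ?_) ?_
    · simp only [IsRoot, eval_mul] at hy ⊢
      rw [hy, mul_zero]
    · rintro rfl
      exact hu hy

open Classical in
theorem sum_signJump_eq (n : ℕ) : ∀ h : ℝ[X], h ≠ 0 → h.natDegree = n →
    ∑ x ∈ h.roots.toFinset, signJump x h =
      if Odd n then (SignType.sign h.leadingCoeff : ℤ) else 0 := by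
  induction n with
  | zero =>
    intro h h0 hn
    rw [eq_C_of_natDegree_eq_zero hn]
    simp
  | succ n ih =>
    intro h h0 hn
    rcases h.roots.toFinset.eq_empty_or_nonempty with he | hne
    · have : Even h.natDegree := even_natDegree_of_no_roots fun y hy => by
        have : y ∈ h.roots.toFinset := by simpa [h0] using hy
        simp [he] at this
      rw [he, Finset.sum_empty, if_neg]
      rwa [← hn, Nat.not_odd_iff_even]
    · obtain ⟨a, ha, hmax⟩ := Finset.exists_max_image _ id hne
      have hra : h.IsRoot a := by simpa [h0] using ha
      obtain ⟨g, rfl⟩ := dvd_iff_isRoot.2 hra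
      have hg : g ≠ 0 := right_ne_zero_of_mul h0
      have hgn : g.natDegree = n := by
        rw [natDegree_mul (X_sub_C_ne_zero a) hg, natDegree_X_sub_C] at hn
        omega
      have hgr : ∀ y, g.IsRoot y → y ≤ a := fun y hy =>
        hmax y (by simp [hg, hy.eq_zero, X_sub_C_ne_zero])
      have hS : ((X - C a) * g).roots.toFinset = insert a (g.roots.toFinset.erase a) := by
        ext y
        simp [roots_mul h0]
        tauto
      have hsum : ∑ x ∈ g.roots.toFinset.erase a, signJump x g =
          ∑ x ∈ g.roots.toFinset, signJump x g - signJump a g := by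
        by_cases hag : a ∈ g.roots.toFinset
        · rw [← Finset.add_sum_erase _ _ hag]; ring
        · rw [Finset.erase_eq_of_notMem hag, signJump_of_eval_ne_zero (h := g), sub_zero]
          simpa [hg] using hag
      rw [hS, Finset.sum_insert (by simp), Finset.sum_congr rfl (fun x hx => ?_),
        Finset.sum_neg_distrib, hsum, ih g hg hgn, leadingCoeff_monic_mul (monic_X_sub_C a)]
      · have := signJump_X_sub_C_mul_self hg hgr
        by_cases ho : Odd n
        · simp only [ho, Nat.odd_add_one]; simp; linarith
        · simp only [ho, Nat.odd_add_one]; simp; linarith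
      · have hx' := Finset.mem_erase.1 hx
        exact signJump_X_sub_C_mul_of_lt
          (lt_of_le_of_ne (hgr x (by simpa [hg] using hx'.2)) hx'.1) g

theorem cauchyIndex_reciprocity {p q : ℝ[X]} (hp : p ≠ 0) (hq : q ≠ 0) :
    cauchyIndex p q + cauchyIndex q p =
      if Odd (p.natDegree + q.natDegree) then
        (SignType.sign (p.leadingCoeff * q.leadingCoeff) : ℤ) else 0 := by
  classical
  have hpq := mul_ne_zero hp hq
  have hS : (p * q).roots.toFinset = p.roots.toFinset ∪ q.roots.toFinset := by
    ext y; simp [roots_mul hpq]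
  have ext_sum : ∀ f g : ℝ[X], f ≠ 0 → f.roots.toFinset ⊆ (p * q).roots.toFinset →
      cauchyIndex f g = ∑ x ∈ (p * q).roots.toFinset,
        if g.rootMultiplicity x < f.rootMultiplicity x then signJump x (f * g) else 0 := by
    intro f g hf hsub
    refine Finset.sum_subset hsub fun x _ hx => if_neg ?_
    rw [rootMultiplicity_eq_zero (p := f) (by simpa [hf] using hx)]
    simp
  rw [ext_sum p q hp (by rw [hS]; exact Finset.subset_union_left),
    ext_sum q p hq (by rw [hS]; exact Finset.subset_union_right), ← Finset.sum_add_distrib,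
    ← natDegree_mul hp hq, ← leadingCoeff_mul, ← sum_signJump_eq _ _ hpq rfl]
  refine Finset.sum_congr rfl fun x _ => ?_
  rw [mul_comm q p]
  rcases lt_trichotomy (p.rootMultiplicity x) (q.rootMultiplicity x) with h | h | h
  · simp [h, h.le]
  · simp [h, signJump, rootMultiplicity_mul hpq]
  · simp [h, h.le]

theorem cauchyIndex_zero_left (q : ℝ[X]) : cauchyIndex 0 q = 0 := by
  simp [cauchyIndex]

theorem cauchyIndex_zero_right (p : ℝ[X]) : cauchyIndex p 0 = 0 := by
  simp [cauchyIndex, signJump_zero]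

theorem jump_term_eq_zero_of_dvd {x : ℝ} {p q : ℝ[X]} (h : (X - C x) ^ p.rootMultiplicity x ∣ q) :
    (if q.rootMultiplicity x < p.rootMultiplicity x then signJump x (p * q) else 0) = 0 := by
  rcases eq_or_ne q 0 with rfl | hq
  · simp [signJump_zero]
  · rw [if_neg (not_lt.2 ((le_rootMultiplicity_iff hq).2 h))]

theorem jump_term_pow_mul {x : ℝ} {u v : ℝ[X]} (hu : u.eval x ≠ 0) (hv : v.eval x ≠ 0)
    {a b : ℕ} (hab : b < a) :
    (if ((X - C x) ^ b * v).rootMultiplicity x < ((X - C x) ^ a * u).rootMultiplicity x then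
      signJump x (((X - C x) ^ a * u) * ((X - C x) ^ b * v)) else 0) =
      if Odd (a + b) then (SignType.sign (u.eval x * v.eval x) : ℤ) else 0 := by
  rw [rootMultiplicity_pow_mul hu, rootMultiplicity_pow_mul hv, if_pos hab,
    show ((X - C x) ^ a * u) * ((X - C x) ^ b * v) = (X - C x) ^ (a + b) * (u * v) by ring,
    signJump_pow_mul (by simp [hu, hv]), eval_mul]

theorem cauchyIndex_add_mul (p q h : ℝ[X]) {c : ℝ} (hc : 0 < c) :
    cauchyIndex p (C c * q + h * p) = cauchyIndex p q := by
  rcases eq_or_ne p 0 with rfl | hp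
  · simp [cauchyIndex_zero_left]
  refine Finset.sum_congr rfl fun x _ => ?_
  by_cases hd : (X - C x) ^ p.rootMultiplicity x ∣ q
  · rw [jump_term_eq_zero_of_dvd hd, jump_term_eq_zero_of_dvd]
    exact dvd_add (hd.mul_left _) ((pow_rootMultiplicity_dvd p x).mul_left _)
  · obtain ⟨a, u, hu, rfl⟩ := exists_eq_pow_mul_eval_ne_zero hp x
    rw [rootMultiplicity_pow_mul hu] at hd
    obtain ⟨b, v, hv, rfl⟩ := exists_eq_pow_mul_eval_ne_zero
      (h := q) (by rintro rfl; simp at hd) x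
    have hba : b < a := by
      by_contra hle
      exact hd ((pow_dvd_pow _ (not_lt.1 hle)).mul_right _)
    obtain ⟨m, rfl⟩ : ∃ m, a = b + (m + 1) := ⟨a - b - 1, by omega⟩
    have hw : (C c * v + h * (X - C x) ^ (m + 1) * u).eval x = c * v.eval x := by simp
    rw [show C c * ((X - C x) ^ b * v) + h * ((X - C x) ^ (b + (m + 1)) * u) =
        (X - C x) ^ b * (C c * v + h * (X - C x) ^ (m + 1) * u) by ring,
      jump_term_pow_mul hu hv hba, jump_term_pow_mul hu (by rw [hw]; positivity) hba, hw,
      mul_left_comm, sign_mul c, sign_pos hc, one_mul]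

theorem cauchyIndex_derivative_mul (p g : ℝ[X]) :
    cauchyIndex p (derivative p * g) =
      ∑ x ∈ p.roots.toFinset, (SignType.sign (g.eval x) : ℤ) := by
  classical
  rw [cauchyIndex]
  refine Finset.sum_congr (by congr) fun x hx => ?_
  have hp : p ≠ 0 := by rintro rfl; simp at hx
  have hr : p.IsRoot x := by simpa [hp] using hx
  obtain ⟨a, u, hu, rfl⟩ := exists_eq_pow_mul_eval_ne_zero hp x
  obtain ⟨m, rfl⟩ : ∃ m, a = m + 1 := by
    refine Nat.exists_eq_succ_of_ne_zero ?_
    rintro rfl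
    simp [IsRoot, hu] at hr
  have hder : derivative ((X - C x) ^ (m + 1) * u) =
      (X - C x) ^ m * (C (m + 1 : ℝ) * u + (X - C x) * derivative u) := by
    rw [derivative_mul, derivative_X_sub_C_pow]
    simp only [Nat.add_sub_cancel, C_add, C_1, map_natCast]
    push_cast
    ring
  rw [hder]
  by_cases hg : g.eval x = 0
  · rw [hg, jump_term_eq_zero_of_dvd]
    · simp
    · obtain ⟨w, rfl⟩ := dvd_iff_isRoot.2 hg
      rw [rootMultiplicity_pow_mul hu]
      exact ⟨(C (m + 1 : ℝ) * u + (X - C x) * derivative u) * w, by ring⟩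
  · have hw : ((C (m + 1 : ℝ) * u + (X - C x) * derivative u) * g).eval x =
        (m + 1) * u.eval x * g.eval x := by simp
    rw [mul_assoc, jump_term_pow_mul hu (by rw [hw]; positivity) (Nat.lt_succ_self m), hw,
      if_pos ⟨m, by omega⟩,
      show u.eval x * ((m + 1) * u.eval x * g.eval x) =
        ((m + 1) * u.eval x ^ 2) * g.eval x by ring, sign_mul, sign_pos (by positivity), one_mul]

end CauchyIndex

section RootFreeIntervals

open Polynomial

/-- A polynomial vanishing at some point of every connected component of the complement of the
zero set of `f`, provided that `f.natDegree < n`. It is the numerator of the logarithmic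
derivative of `f ^ 2 / (1 + X ^ 2) ^ n`. -/
noncomputable def criticalPoly {R : Type*} [CommRing R] (n : ℕ) (f : R[X]) : R[X] :=
  (1 + X ^ 2) * derivative f - C (n : R) * X * f

theorem map_criticalPoly {R S : Type*} [CommRing R] [CommRing S] (φ : R →+* S) (n : ℕ)
    (f : R[X]) : (criticalPoly n f).map φ = criticalPoly n (f.map φ) := by
  simp [criticalPoly, derivative_map]

theorem criticalPoly_ne_zero {f : ℝ[X]} (hf : f ≠ 0) {n : ℕ} (hn : f.natDegree < n) :
    criticalPoly n f ≠ 0 := by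
  intro h
  have hc : (criticalPoly n f).coeff (f.natDegree + 1) =
      ((f.natDegree : ℝ) - n) * f.leadingCoeff := by
    have h1 : (derivative f).coeff (f.natDegree + 1) = 0 := by
      rw [coeff_derivative, coeff_eq_zero_of_natDegree_lt (by omega), zero_mul]
    have h2 : (X ^ 2 * derivative f).coeff (f.natDegree + 1) = f.natDegree * f.leadingCoeff := by
      rcases Nat.eq_zero_or_pos f.natDegree with h0 | h0
      · rw [derivative_of_natDegree_zero h0]; simp [h0]
      · obtain ⟨d, hd⟩ := Nat.exists_eq_succ_of_ne_zero h0.ne'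
        rw [leadingCoeff, hd, show d.succ + 1 = d + 2 from rfl, coeff_X_pow_mul, coeff_derivative]
        push_cast
        ring
    rw [criticalPoly, coeff_sub, add_mul, one_mul, coeff_add, h1, h2, mul_assoc, coeff_C_mul,
      coeff_X_mul, leadingCoeff]
    ring
  rw [h, coeff_zero, eq_comm, mul_eq_zero, leadingCoeff_eq_zero, sub_eq_zero, Nat.cast_inj] at hc
  exact hc.elim hn.ne hf

theorem exists_criticalPoly_root {f : ℝ[X]} {n : ℕ} (hn : f.natDegree < n) {x : ℝ}
    (hx : f.eval x ≠ 0) :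
    ∃ t, (criticalPoly n f).eval t = 0 ∧ ∀ z ∈ uIcc x t, f.eval z ≠ 0 := by
  have hpos : ∀ z : ℝ, 0 < (1 + z ^ 2) ^ n := fun z => by positivity
  set φ : ℝ → ℝ := fun z => f.eval z ^ 2 / (1 + z ^ 2) ^ n with hφ
  have hφc : Continuous φ :=
    (f.continuous.pow 2).div (by fun_prop) fun z => (hpos z).ne'
  have hφx : 0 < φ x := div_pos (by positivity) (hpos x)
  set U : Set ℝ := {z | f.eval z ≠ 0}
  have hU : IsOpen U := isOpen_ne_fun f.continuous continuous_const
  set K := connectedComponentIn U x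
  have hK : IsOpen K := hU.connectedComponentIn
  have hxK : x ∈ K := mem_connectedComponentIn hx
  have hclK : closure K ∩ U ⊆ K := by
    refine IsPreconnected.subset_connectedComponentIn
      (isPreconnected_connectedComponentIn.subset_closure (s := K) (fun z hz => ?_)
        inter_subset_left) ⟨subset_closure hxK, hx⟩ inter_subset_right
    exact ⟨subset_closure hz, connectedComponentIn_subset U x hz⟩
  have htend : Filter.Tendsto φ (Filter.cocompact ℝ) (nhds 0) := by
    have hdeg : (f ^ 2).degree < ((1 + X ^ 2 : ℝ[X]) ^ n).degree := by
      have h1 : (1 + X ^ 2 : ℝ[X]).natDegree = 2 := by compute_degree!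
      have h2 : (1 + X ^ 2 : ℝ[X]) ≠ 0 := by
        intro h; rw [h] at h1; simp at h1
      refine degree_lt_degree ?_
      rw [natDegree_pow, natDegree_pow, h1]
      omega
    have e : φ = fun z => (f ^ 2).eval z / ((1 + X ^ 2 : ℝ[X]) ^ n).eval z := by
      ext z; simp [hφ]
    rw [cocompact_eq_atBot_atTop, e]
    exact Filter.Tendsto.sup (div_tendsto_atBot_zero_of_degree_lt _ _ hdeg)
      (div_tendsto_atTop_zero_of_degree_lt _ _ hdeg)
  set L : Set ℝ := {z | φ x ≤ φ z} ∩ closure K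
  have hLK : L ⊆ K := fun z hz => hclK ⟨hz.2, fun h0 => by
    have h1 : φ x ≤ φ z := hz.1
    have h2 : φ z = 0 := by simp [hφ, h0]
    linarith⟩
  have hLc : IsCompact L := by
    refine IsCompact.inter_right ?_ isClosed_closure
    obtain ⟨T, hT, hTs⟩ := Filter.mem_cocompact.1 (htend (Iio_mem_nhds hφx))
    refine hT.of_isClosed_subset (isClosed_le continuous_const hφc) fun z hz => ?_
    by_contra hzT
    exact not_lt_of_ge (show φ x ≤ φ z from hz) (hTs hzT)
  obtain ⟨t, htL, hmax⟩ := hLc.exists_isMaxOn ⟨x, le_refl (φ x), subset_closure hxK⟩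
    hφc.continuousOn
  have htK := hLK htL
  have hft : f.eval t ≠ 0 := connectedComponentIn_subset U x htK
  refine ⟨t, ?_, fun z hz => connectedComponentIn_subset U x
    (isPreconnected_connectedComponentIn.ordConnected.uIcc_subset hxK htK hz)⟩
  set p : ℝ[X] := C (φ t) * (1 + X ^ 2) ^ n - f ^ 2 with hp
  have hpz : ∀ z, p.eval z = (φ t - φ z) * (1 + z ^ 2) ^ n := fun z => by
    have := (hpos z).ne'
    simp only [hp, hφ, eval_sub, eval_mul, eval_C, eval_pow, eval_add, eval_one, eval_X]
    field_simp
  have hmin : IsLocalMin (fun z => p.eval z) t := by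
    filter_upwards [hK.mem_nhds htK] with z hz
    rw [hpz, hpz, sub_self, zero_mul]
    refine mul_nonneg (sub_nonneg.2 ?_) (hpos z).le
    rcases le_total (φ x) (φ z) with h | h
    · exact hmax ⟨h, subset_closure hz⟩
    · exact h.trans htL.1
  have hd := hmin.hasDerivAt_eq_zero (p.hasDerivAt t)
  obtain ⟨m, rfl⟩ : ∃ m, n = m + 1 := ⟨n - 1, by omega⟩
  have hφt : φ t * (1 + t ^ 2) ^ (m + 1) = f.eval t ^ 2 := div_mul_cancel₀ _ (hpos t).ne'
  simp only [hp, derivative_sub, derivative_mul, derivative_C, zero_mul, zero_add, derivative_pow,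
    derivative_add, derivative_one, derivative_X, eval_sub, eval_mul, eval_C, eval_pow, eval_add,
    eval_one, eval_X, Nat.add_sub_cancel, mul_one, map_natCast, eval_natCast] at hd
  simp only [criticalPoly, eval_sub, eval_mul, eval_C, eval_pow, eval_add, eval_one, eval_X]
  refine (mul_eq_zero.1 (?_ : f.eval t * _ = 0)).resolve_left hft
  push_cast at hd ⊢
  linear_combination (-(1 + t ^ 2) / 2) * hd + ((m : ℝ) + 1) * t * hφt

end RootFreeIntervals

open Classical in
/-- Functions on `Y` computed by a finite decision tree whose branchings test the positivity of
elements of `R`, evaluated at the points of `Y` through `ev`. -/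
inductive IsSignTree {R Y β : Type*} [CommRing R] (ev : Y → R →+* ℝ) : (Y → β) → Prop
  | const (b : β) : IsSignTree ev fun _ => b
  | branch (r : R) {f g : Y → β} : IsSignTree ev f → IsSignTree ev g →
      IsSignTree ev fun y => if 0 < ev y r then f y else g y

namespace IsSignTree

section Basic

variable {R R' Y Y' β γ δ : Type*} [CommRing R] [CommRing R'] {ev : Y → R →+* ℝ}
  {ev' : Y' → R' →+* ℝ}

theorem congr {f g : Y → β} (hf : IsSignTree ev f) (h : ∀ y, f y = g y) : IsSignTree ev g :=
  funext h ▸ hf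

theorem bind {f : Y → β} (hf : IsSignTree ev f) {g : β → Y → γ} (hg : ∀ b, IsSignTree ev (g b)) :
    IsSignTree ev fun y => g (f y) y := by
  induction hf with
  | const b => exact hg b
  | branch r _ _ ih₁ ih₂ =>
    refine (branch r ih₁ ih₂).congr fun y => ?_
    dsimp only
    split_ifs <;> rfl

theorem map {f : Y → β} (hf : IsSignTree ev f) (φ : β → γ) : IsSignTree ev fun y => φ (f y) :=
  hf.bind fun b => const (φ b)

theorem map₂ {f : Y → β} {g : Y → γ} (hf : IsSignTree ev f) (hg : IsSignTree ev g)
    (φ : β → γ → δ) : IsSignTree ev fun y => φ (f y) (g y) :=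
  hf.bind fun b => hg.map (φ b)

open Classical in
theorem ite {P : Y → Prop} {f g : Y → β} (hP : IsSignTree ev P) (hf : IsSignTree ev f)
    (hg : IsSignTree ev g) : IsSignTree ev fun y => if P y then f y else g y :=
  hP.bind (g := fun b y => if b then f y else g y) fun b => by
    by_cases hb : b
    · exact hf.congr fun y => by simp [hb]
    · exact hg.congr fun y => by simp [hb]

theorem pos (ev : Y → R →+* ℝ) (r : R) : IsSignTree ev fun y => 0 < ev y r :=
  (branch r (const True) (const False)).congr fun y => by simp

theorem sign (ev : Y → R →+* ℝ) (r : R) : IsSignTree ev fun y => SignType.sign (ev y r) :=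
  (branch r (const 1) (branch (-r) (const (-1)) (const 0))).congr fun y => by
    rw [map_neg]
    split_ifs with h1 h2
    · rw [sign_pos h1]
    · rw [sign_neg (by linarith)]
    · rw [show ev y r = 0 by linarith, sign_zero]

theorem eq_zero (ev : Y → R →+* ℝ) (r : R) : IsSignTree ev fun y => ev y r = 0 :=
  ((sign ev r).map fun s => s = 0).congr fun y => by simp [sign_eq_zero_iff]

theorem forall_mem_finset {ι : Type*} (s : Finset ι) {P : ι → Y → Prop}
    (hP : ∀ i, IsSignTree ev (P i)) : IsSignTree ev fun y => ∀ i ∈ s, P i y := by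
  classical
  induction s using Finset.induction_on with
  | empty => exact (const True).congr fun y => by simp
  | insert i s _ ih => exact ((hP i).map₂ ih And).congr fun y => by simp

theorem pi {n : ℕ} {f : Fin n → Y → β} (hf : ∀ i, IsSignTree ev (f i)) :
    IsSignTree ev fun y i => f i y := by
  induction n with
  | zero => exact (const Fin.elim0).congr fun y => funext fun i => i.elim0
  | succ n ih =>
    refine ((hf 0).map₂ (ih fun i => hf i.succ) fun b v => (Fin.cons b v : Fin (n + 1) → β)).congr
      fun y => funext fun i => ?_
    cases i using Fin.cases <;> rfl

theorem comap {f : Y → β} (hf : IsSignTree ev f) (g : Y' → Y) (φ : R →+* R')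
    (h : ∀ y r, ev (g y) r = ev' y (φ r)) : IsSignTree ev' fun y => f (g y) := by
  induction hf with
  | const b => exact const b
  | branch r _ _ ih₁ ih₂ =>
    exact (branch (φ r) ih₁ ih₂).congr fun y => by simp only [h]

end Basic

section Elimination

open Polynomial

variable {R Y : Type*} [CommRing R] {ev : Y → R →+* ℝ}

theorem map_eq_zero (ev : Y → R →+* ℝ) (p : R[X]) :
    IsSignTree ev fun y => p.map (ev y) = 0 :=
  (forall_mem_finset p.support fun i => eq_zero ev (p.coeff i)).congr fun y => by
    rw [eq_iff_iff]
    constructor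
    · intro h
      ext i
      rw [coeff_map, coeff_zero]
      by_cases hi : i ∈ p.support
      · exact h i hi
      · rw [notMem_support_iff.1 hi, map_zero]
    · intro h i _
      rw [← coeff_map, h, coeff_zero]

theorem cauchyIndex_of_degree_lt (ev : Y → R →+* ℝ) (N : ℕ) : ∀ n m : ℕ, n + m ≤ N →
    ∀ p q : R[X], p.degree < n → q.degree < m →
      IsSignTree ev fun y => cauchyIndex (p.map (ev y)) (q.map (ev y)) := by
  classical
  have hcut : ∀ (p : R[X]) (n : ℕ), p.degree < (n + 1 : ℕ) →
      (p - C (p.coeff n) * X ^ n).degree < (n : WithBot ℕ) := by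
    intro p n hp
    rw [degree_lt_iff_coeff_zero] at hp ⊢
    intro i hi
    rw [coeff_sub, coeff_C_mul_X_pow]
    rcases hi.eq_or_lt with rfl | hi
    · simp
    · rw [hp i hi, if_neg hi.ne', sub_zero]
  have hcutmap : ∀ (p : R[X]) (n : ℕ) (y : Y), ev y (p.coeff n) = 0 →
      (p - C (p.coeff n) * X ^ n).map (ev y) = p.map (ev y) := by
    intro p n y h
    simp [Polynomial.map_sub, Polynomial.map_mul, h]
  have hred : ∀ (p q : R[X]) (n m : ℕ), n ≤ m → p.degree < (n + 1 : ℕ) → q.degree < (m + 1 : ℕ) →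
      (C (p.coeff n ^ 2) * q - C (p.coeff n * q.coeff m) * X ^ (m - n) * p).degree <
        (m : WithBot ℕ) := by
    intro p q n m hnm hp hq
    rw [degree_lt_iff_coeff_zero] at hp hq ⊢
    intro i hi
    obtain ⟨j, rfl⟩ := Nat.exists_eq_add_of_le hi
    rw [coeff_sub, coeff_C_mul, mul_assoc, coeff_C_mul,
      show m + j = (n + j) + (m - n) by omega, coeff_X_pow_mul,
      show (n + j) + (m - n) = m + j by omega]
    rcases Nat.eq_zero_or_pos j with rfl | hj
    · simp only [add_zero]; ring
    · rw [hp (n + j) (by omega), hq (m + j) (by omega)]; ring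
  have hredmap : ∀ (p q : R[X]) (n m : ℕ) (y : Y), ev y (p.coeff n) ≠ 0 →
      cauchyIndex (p.map (ev y)) ((C (p.coeff n ^ 2) * q -
        C (p.coeff n * q.coeff m) * X ^ (m - n) * p).map (ev y)) =
        cauchyIndex (p.map (ev y)) (q.map (ev y)) := by
    intro p q n m y h
    rw [← cauchyIndex_add_mul (p.map (ev y)) (q.map (ev y))
      (-((C (p.coeff n * q.coeff m) * X ^ (m - n)).map (ev y)))
      (show 0 < ev y (p.coeff n) ^ 2 by positivity)]
    congr 1
    simp only [Polynomial.map_sub, Polynomial.map_mul, Polynomial.map_pow, map_C, map_pow]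
    ring
  have ne_zero_map : ∀ {p : R[X]} {n : ℕ} {y : Y}, p.degree < (n + 1 : ℕ) →
      ev y (p.coeff n) ≠ 0 → p.map (ev y) ≠ 0 := by
    intro p n y _ h h0
    rw [← coeff_map, h0, coeff_zero] at h
    exact h rfl
  have natDegree_map : ∀ {p : R[X]} {n : ℕ} {y : Y}, p.degree < (n + 1 : ℕ) →
      ev y (p.coeff n) ≠ 0 → (p.map (ev y)).natDegree = n := by
    intro p n y hp h
    refine natDegree_eq_of_le_of_coeff_ne_zero (natDegree_le_iff_coeff_eq_zero.2 fun i hi => ?_)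
      (by rwa [coeff_map])
    rw [coeff_map, (degree_lt_iff_coeff_zero _ _).1 hp i hi, map_zero]
  induction N with
  | zero =>
    intro n m hN p q hp hq
    obtain rfl : n = 0 := by omega
    have : p = 0 := by simpa [Polynomial.degree_lt_iff_coeff_zero, Polynomial.ext_iff] using hp
    exact (const 0).congr fun y => by simp [this, cauchyIndex_zero_left]
  | succ N ih =>
    intro n m hN p q hp hq
    cases n with
    | zero =>
      have : p = 0 := by simpa [Polynomial.degree_lt_iff_coeff_zero, Polynomial.ext_iff] using hp
      exact (const 0).congr fun y => by simp [this, cauchyIndex_zero_left]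
    | succ n =>
    cases m with
    | zero =>
      have : q = 0 := by simpa [Polynomial.degree_lt_iff_coeff_zero, Polynomial.ext_iff] using hq
      exact (const 0).congr fun y => by simp [this, cauchyIndex_zero_right]
    | succ m =>
    have hp0 := ih n (m + 1) (by omega) _ q (hcut p n hp) hq
    have hq0 := ih (n + 1) m (by omega) p _ hp (hcut q m hq)
    have hmain : IsSignTree ev fun y => if ev y (p.coeff n) ≠ 0 ∧ ev y (q.coeff m) ≠ 0 then
        cauchyIndex (p.map (ev y)) (q.map (ev y)) else 0 := by
      have hne := (eq_zero ev (p.coeff n)).map₂ (eq_zero ev (q.coeff m)) fun a b => ¬ a ∧ ¬ b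
      rcases le_total n m with hnm | hnm
      · refine (hne.ite (ih (n + 1) m (by omega) p _ hp (hred p q n m hnm hp hq))
          (const 0)).congr fun y => ?_
        split_ifs with h
        · exact hredmap p q n m y h.1
        · rfl
      · have hsign := (sign ev (p.coeff n)).map₂ (sign ev (q.coeff m)) fun a b =>
          if Odd (n + m) then ((a * b : SignType) : ℤ) else 0
        refine (hne.ite (hsign.map₂ (ih (m + 1) n (by omega) q _ hq (hred q p m n hnm hq hp))
          fun a b => a - b) (const 0)).congr fun y => ?_
        split_ifs with h h'
        all_goals try rfl
        all_goals
          rw [hredmap q p m n y h.2, eq_comm, eq_sub_iff_add_eq,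
            cauchyIndex_reciprocity (ne_zero_map hp h.1) (ne_zero_map hq h.2),
            natDegree_map hp h.1, natDegree_map hq h.2]
          simp [leadingCoeff, natDegree_map hp h.1, natDegree_map hq h.2, sign_mul, h']
    refine ((eq_zero ev (p.coeff n)).ite hp0 ((eq_zero ev (q.coeff m)).ite hq0 hmain)).congr
      fun y => ?_
    split_ifs with h1 h2 h3
    · rw [hcutmap p n y h1]
    · rw [hcutmap q m y h2]
    · rfl
    · exact absurd ⟨h1, h2⟩ h3

theorem cauchyIndex (ev : Y → R →+* ℝ) (p q : R[X]) :
    IsSignTree ev fun y => _root_.cauchyIndex (p.map (ev y)) (q.map (ev y)) :=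
  cauchyIndex_of_degree_lt ev _ (p.natDegree + 1) (q.natDegree + 1) le_rfl p q
    (by exact_mod_cast degree_le_natDegree.trans_lt (by exact_mod_cast Nat.lt_succ_self _))
    (by exact_mod_cast degree_le_natDegree.trans_lt (by exact_mod_cast Nat.lt_succ_self _))

/-- Evaluation of polynomials over `R` at points of `Y × ℝ`. -/
noncomputable def _root_.polyEval (ev : Y → R →+* ℝ) (z : Y × ℝ) : R[X] →+* ℝ :=
  eval₂RingHom (ev z.1) z.2

theorem _root_.polyEval_eq_eval_map (ev : Y → R →+* ℝ) (y : Y) (x : ℝ) (p : R[X]) :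
    polyEval ev (y, x) p = (p.map (ev y)).eval x :=
  (eval_map _ _).symm

open Classical in
theorem sum_roots_sign {P : Y × ℝ → Prop} (hP : IsSignTree (polyEval ev) P) (f : R[X]) :
    ∀ h : R[X], IsSignTree ev fun y => ∑ x ∈ (f.map (ev y)).roots.toFinset,
      if P (y, x) then (SignType.sign ((h.map (ev y)).eval x) : ℤ) else 0 := by
  induction hP with
  | const b =>
    intro h
    by_cases hb : b
    · exact (cauchyIndex ev f (derivative f * h)).congr fun y => by
        simp only [hb, if_true]
        rw [Polynomial.map_mul, ← derivative_map, cauchyIndex_derivative_mul]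
    · exact (const 0).congr fun y => by simp [hb]
  | @branch r P Q _ _ ihP ihQ =>
    intro h
    refine (((ihP (h * r)).map₂ (ihP (h * r ^ 2)) (· + ·)).map₂
      ((ihQ h).map₂ ((ihQ (h * r)).map₂ (ihQ (h * r ^ 2)) (· + ·)) fun c d => 2 * c - d)
      fun a b => (a + b) / 2).congr fun y => ?_
    refine Int.ediv_eq_of_eq_mul_right two_ne_zero ?_
    simp only [Finset.mul_sum, ← Finset.sum_add_distrib, ← Finset.sum_sub_distrib]
    refine Finset.sum_congr rfl fun x _ => ?_
    simp only [polyEval_eq_eval_map, Polynomial.map_mul, Polynomial.map_pow, eval_mul, eval_pow,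
      sign_mul, sign_pow]
    rcases lt_trichotomy ((r.map (ev y)).eval x) 0 with hr | hr | hr
    · by_cases h1 : P (y, x) <;> by_cases h2 : Q (y, x) <;> simp [h1, h2, hr, not_lt_of_gt hr]
    · by_cases h1 : P (y, x) <;> by_cases h2 : Q (y, x) <;> simp [h1, h2, hr]
    · by_cases h1 : P (y, x) <;> by_cases h2 : Q (y, x) <;> simp [h1, h2, hr]
      all_goals ring

theorem exists_root {P : Y × ℝ → Prop} (hP : IsSignTree (polyEval ev) P) (f : R[X]) :
    IsSignTree ev fun y => ∃ x ∈ (f.map (ev y)).roots, P (y, x) := by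
  classical
  refine ((sum_roots_sign hP f 1).map fun n => n ≠ 0).congr fun y => ?_
  have : ∀ x, (if P (y, x) then (SignType.sign (((1 : R[X]).map (ev y)).eval x) : ℤ) else 0) =
      if P (y, x) then 1 else 0 := fun x => by simp
  simp only [this, ne_eq, eq_iff_iff]
  rw [Finset.sum_eq_zero_iff_of_nonneg fun x _ => by split_ifs <;> norm_num]
  simp [and_assoc]

/-- For each parameter, a sign tree is constant on the intervals that avoid the zeros of a
suitable nonzero polynomial. -/
theorem exists_separating {P : Y × ℝ → β} (hP : IsSignTree (polyEval ev) P) :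
    ∃ F : Y → R[X], IsSignTree ev F ∧ (∀ y, (F y).map (ev y) ≠ 0) ∧
      ∀ y a b, (∀ x ∈ uIcc a b, ((F y).map (ev y)).eval x ≠ 0) → P (y, a) = P (y, b) := by
  classical
  induction hP with
  | const b => exact ⟨fun _ => 1, const 1, by simp, by simp⟩
  | @branch r P Q _ _ ihP ihQ =>
    obtain ⟨F, hF, hF0, hFc⟩ := ihP
    obtain ⟨G, hG, hG0, hGc⟩ := ihQ
    refine ⟨fun y => if r.map (ev y) = 0 then G y else r * (F y * G y),
      ((map_eq_zero ev r).ite hG (hF.map₂ hG fun a b => r * (a * b))).congr fun y => by congr,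
      fun y => ?_, ?_⟩
    · dsimp only
      split_ifs with hr
      · exact hG0 y
      · simp [hr, hF0 y, hG0 y]
    · intro y a b h
      simp only [polyEval_eq_eval_map]
      by_cases hr : r.map (ev y) = 0
      · simp only [hr, if_true] at h
        simpa [hr] using hGc y a b h
      · simp only [hr, if_false, Polynomial.map_mul, eval_mul] at h
        have hsign : 0 < (r.map (ev y)).eval a ↔ 0 < (r.map (ev y)).eval b := by
          have hpre : (r.map (ev y)).eval '' uIcc a b ⊆ {0}ᶜ := by
            rintro _ ⟨x, hx, rfl⟩
            exact left_ne_zero_of_mul (h x hx)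
          have hcon := ((isPreconnected_uIcc (a := a) (b := b)).image _
            (r.map (ev y)).continuous.continuousOn).ordConnected
          have ha := mem_image_of_mem (r.map (ev y)).eval (left_mem_uIcc (a := a) (b := b))
          have hb := mem_image_of_mem (r.map (ev y)).eval (right_mem_uIcc (a := a) (b := b))
          constructor
          · intro h0
            by_contra h1
            exact hpre (hcon.out hb ha ⟨not_lt.1 h1, h0.le⟩) rfl
          · intro h0
            by_contra h1
            exact hpre (hcon.out ha hb ⟨not_lt.1 h1, h0.le⟩) rfl
        rw [if_congr hsign rfl rfl,
          hFc y a b fun x hx => left_ne_zero_of_mul (right_ne_zero_of_mul (h x hx)),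
          hGc y a b fun x hx => right_ne_zero_of_mul (right_ne_zero_of_mul (h x hx))]

theorem exists_real {P : Y × ℝ → Prop} (hP : IsSignTree (polyEval ev) P) :
    IsSignTree ev fun y => ∃ x, P (y, x) := by
  obtain ⟨F, hF, hF0, hFc⟩ := exists_separating hP
  refine (hF.bind fun f => exists_root hP (f * criticalPoly (f.natDegree + 1) f)).congr
    fun y => ?_
  rw [eq_iff_iff]
  constructor
  · rintro ⟨x, _, hx⟩
    exact ⟨x, hx⟩
  · rintro ⟨x, hx⟩
    have hn : ((F y).map (ev y)).natDegree < (F y).natDegree + 1 :=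
      Nat.lt_succ_of_le natDegree_map_le
    have hne := mul_ne_zero (hF0 y) (criticalPoly_ne_zero (hF0 y) hn)
    simp only [Polynomial.map_mul, map_criticalPoly, mem_roots hne, IsRoot, eval_mul, mul_eq_zero]
    by_cases h0 : ((F y).map (ev y)).eval x = 0
    · exact ⟨x, Or.inl h0, hx⟩
    · obtain ⟨t, ht, htx⟩ := exists_criticalPoly_root hn h0
      exact ⟨t, Or.inr ht, hFc y x t htx ▸ hx⟩

end Elimination

section MultivariateElimination

open MvPolynomial

variable {R Y : Type*} [CommRing R] {ev : Y → R →+* ℝ}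

/-- Evaluation of polynomials over `R` at points of `Y × (σ → ℝ)`. -/
noncomputable def _root_.mvPolyEval {σ : Type*} (ev : Y → R →+* ℝ) (z : Y × (σ → ℝ)) :
    MvPolynomial σ R →+* ℝ :=
  eval₂Hom (ev z.1) z.2

theorem exists_fin {l : ℕ} {P : Y × (Fin l → ℝ) → Prop} (hP : IsSignTree (mvPolyEval ev) P) :
    IsSignTree ev fun y => ∃ v, P (y, v) := by
  induction l with
  | zero =>
    refine (hP.comap (ev' := ev) (fun y => (y, Fin.elim0)) (eval₂Hom (RingHom.id R) Fin.elim0)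
      fun y r => ?_).congr fun y => by simp [Unique.exists_iff, Subsingleton.elim default Fin.elim0]
    have : mvPolyEval ev (y, Fin.elim0) = (ev y).comp (eval₂Hom (RingHom.id R) Fin.elim0) :=
      ringHom_ext (fun a => by simp [mvPolyEval]) fun i => i.elim0
    rw [this]
    rfl
  | succ l ih =>
    refine (ih (P := fun z => ∃ x, P (z.1, Fin.cons x z.2)) (exists_real
      (hP.comap (ev' := polyEval (mvPolyEval ev))
        (fun z : (Y × (Fin l → ℝ)) × ℝ => (z.1.1, (Fin.cons z.2 z.1.2 : Fin (l + 1) → ℝ)))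
        (finSuccEquiv R l : MvPolynomial (Fin (l + 1)) R →+* Polynomial (MvPolynomial (Fin l) R))
        fun z r => ?_))).congr fun y => ?_
    · have : mvPolyEval ev (z.1.1, (Fin.cons z.2 z.1.2 : Fin (l + 1) → ℝ)) =
          (polyEval (mvPolyEval ev) z).comp (finSuccEquiv R l :
            MvPolynomial (Fin (l + 1)) R →+* Polynomial (MvPolynomial (Fin l) R)) := by
        refine ringHom_ext (fun a => ?_) fun i => ?_
        · simp [mvPolyEval, polyEval, finSuccEquiv_apply]
        · cases i using Fin.cases with
          | zero => simp [mvPolyEval, polyEval, finSuccEquiv_X_zero]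
          | succ i => simp [mvPolyEval, polyEval, finSuccEquiv_X_succ]
      rw [this]
      rfl
    · rw [eq_iff_iff]
      constructor
      · rintro ⟨v, x, h⟩
        exact ⟨_, h⟩
      · rintro ⟨v, h⟩
        exact ⟨Fin.tail v, v 0, by rwa [Fin.cons_self_tail]⟩

end MultivariateElimination

end IsSignTree

section Presentations

open MvPolynomial

variable {n : ℕ}

theorem SAPres.toSet_append (p q : SAPres n) :
    SAPres.toSet (p ++ q) = p.toSet ∪ q.toSet := by
  ext x
  simp only [SAPres.toSet, mem_ofPred_eq, mem_union, List.mem_append, or_and_right, exists_or]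

theorem SAPres.deg_append (p q : SAPres n) : SAPres.deg (p ++ q) = p.deg + q.deg := by
  simp [SAPres.deg]

/-- Add the condition `0 < r` to every clause of a presentation. -/
noncomputable def SAPres.addPos (r : MvPolynomial (Fin n) ℝ) (p : SAPres n) : SAPres n :=
  p.map fun c => (r :: c.1, c.2)

/-- Add the condition `r = 0` to every clause of a presentation. -/
noncomputable def SAPres.addZero (r : MvPolynomial (Fin n) ℝ) (p : SAPres n) : SAPres n :=
  p.map fun c => (c.1, r :: c.2)

theorem SAPres.toSet_addPos (r : MvPolynomial (Fin n) ℝ) (p : SAPres n) :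
    (p.addPos r).toSet = {x | 0 < eval x r} ∩ p.toSet := by
  ext x
  simp [SAPres.toSet, SAPres.addPos]
  grind

theorem SAPres.toSet_addZero (r : MvPolynomial (Fin n) ℝ) (p : SAPres n) :
    (p.addZero r).toSet = {x | eval x r = 0} ∩ p.toSet := by
  ext x
  simp [SAPres.toSet, SAPres.addZero]
  grind

theorem SAPres.deg_addPos (r : MvPolynomial (Fin n) ℝ) (p : SAPres n) :
    (p.addPos r).deg = p.length * r.totalDegree + p.deg := by
  induction p with
  | nil => simp [SAPres.addPos, SAPres.deg]
  | cons c p ih =>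
    simp only [SAPres.addPos, SAPres.deg, List.map_cons, List.sum_cons, List.length_cons] at ih ⊢
    rw [ih]
    ring

theorem SAPres.deg_addZero (r : MvPolynomial (Fin n) ℝ) (p : SAPres n) :
    (p.addZero r).deg = p.length * r.totalDegree + p.deg := by
  induction p with
  | nil => simp [SAPres.addZero, SAPres.deg]
  | cons c p ih =>
    simp only [SAPres.addZero, SAPres.deg, List.map_cons, List.sum_cons, List.length_cons] at ih ⊢
    rw [ih]
    ring

/-- The slices of a set cut out by a sign tree have presentations of uniformly bounded size. -/
theorem IsSignTree.exists_presentation {W : Type*} {P : W × (Fin n → ℝ) → Prop}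
    (hP : IsSignTree (mvPolyEval fun w => Pi.evalRingHom (fun _ : W => ℝ) w) P) :
    ∃ N B, ∀ w, ∃ p : SAPres n, p.toSet = {y | P (w, y)} ∧ p.length ≤ N ∧ p.deg ≤ B := by
  induction hP with
  | const b =>
    by_cases hb : b
    · exact ⟨1, 0, fun w => ⟨[([], [])], by simp [SAPres.toSet, hb], by simp, by simp [SAPres.deg]⟩⟩
    · exact ⟨0, 0, fun w => ⟨[], by simp [SAPres.toSet, hb], by simp, by simp [SAPres.deg]⟩⟩
  | @branch r P Q _ _ ihP ihQ =>
    obtain ⟨N, B, hP⟩ := ihP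
    obtain ⟨N', B', hQ⟩ := ihQ
    refine ⟨N + (N' + N'), (N * r.totalDegree + B) +
      ((N' * r.totalDegree + B') + (N' * r.totalDegree + B')), fun w => ?_⟩
    obtain ⟨p, hp, hpN, hpB⟩ := hP w
    obtain ⟨q, hq, hqN, hqB⟩ := hQ w
    set s := MvPolynomial.map (Pi.evalRingHom (fun _ : W => ℝ) w) r with hs
    have hsr : s.totalDegree ≤ r.totalDegree := Finset.sup_mono (support_map_subset _ _)
    have heval : ∀ y, mvPolyEval (fun w => Pi.evalRingHom (fun _ : W => ℝ) w) (w, y) r =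
        eval y s := fun y => (eval_map _ _ _).symm
    refine ⟨p.addPos s ++ (q.addPos (-s) ++ q.addZero s), ?_, ?_, ?_⟩
    · ext y
      simp only [SAPres.toSet_append, SAPres.toSet_addPos, SAPres.toSet_addZero, hp, hq, mem_union,
        mem_inter_iff, mem_ofPred_eq, heval, map_neg]
      split_ifs with h
      · simp [h, h.ne', not_lt_of_gt h]
      · rcases (not_lt.1 h).lt_or_eq with h' | h'
        · simp [h, h']
        · simp [h']
    · simp only [List.length_append, SAPres.addPos, SAPres.addZero, List.length_map]
      omega
    · simp only [SAPres.deg_append, SAPres.deg_addPos, SAPres.deg_addZero, totalDegree_neg]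
      gcongr

/-- Membership in a presented set depends only on the signs of boundedly many polynomials of
bounded degree. -/
theorem SAPres.exists_sign_condition (p : SAPres n) :
    ∃ (Q : Fin p.deg → MvPolynomial (Fin n) ℝ) (S : Set (Fin p.deg → SignType)),
      (∀ i, (Q i).totalDegree ≤ p.deg) ∧
        p.toSet = {x | (fun i => SignType.sign (eval x (Q i))) ∈ S} := by
  set M := p.flatMap fun c => c.1 ++ c.2 with hM
  set L := M.filter fun P => P.totalDegree ≠ 0 with hL
  have hdeg : p.deg = (M.map totalDegree).sum := by
    rw [hM]
    clear_value M
    clear hM hL L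
    induction p with
    | nil => simp [SAPres.deg]
    | cons c p ih =>
      simp only [SAPres.deg, List.map_cons, List.sum_cons, List.flatMap_cons, List.map_append,
        List.sum_append] at ih ⊢
      rw [ih]
  have hlen : L.length ≤ p.deg := by
    have h1 : (L.map totalDegree).length ≤ (L.map totalDegree).sum :=
      List.length_le_sum_of_one_le _ fun i hi => by
        obtain ⟨P, hP, rfl⟩ := List.mem_map.1 hi
        rw [hL, List.mem_filter] at hP
        exact Nat.one_le_iff_ne_zero.2 (by simpa using hP.2)
    have h2 : (L.map totalDegree).sum ≤ (M.map totalDegree).sum :=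
      (List.filter_sublist.map _).sum_le_sum fun _ _ => Nat.zero_le _
    rw [List.length_map] at h1
    omega
  refine ⟨fun i => L.getD i 0,
    (fun x i => SignType.sign (eval x (L.getD (i : ℕ) 0))) '' p.toSet, fun i => ?_, ?_⟩
  · by_cases hi : (i : ℕ) < L.length
    · dsimp only
      rw [List.getD_eq_getElem _ _ hi]
      exact (List.le_sum_of_mem
        (List.mem_map_of_mem (List.mem_of_mem_filter (List.getElem_mem hi)))).trans_eq hdeg.symm
    · dsimp only
      rw [List.getD_eq_default _ _ (not_lt.1 hi), totalDegree_zero]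
      exact Nat.zero_le _
  · refine Subset.antisymm (fun x hx => mem_image_of_mem _ hx) ?_
    rintro x ⟨x', ⟨c, hc, hpos, hzero⟩, hx⟩
    have hsign : ∀ P ∈ M, SignType.sign (eval x' P) = SignType.sign (eval x P) := by
      intro P hP
      by_cases h0 : P.totalDegree = 0
      · rw [totalDegree_eq_zero_iff_eq_C.1 h0, eval_C, eval_C]
      · obtain ⟨i, hi, rfl⟩ : ∃ i, ∃ hi : i < L.length, L[i] = P := List.getElem_of_mem
          (List.mem_filter.2 ⟨hP, by simpa using h0⟩)
        have := congrFun hx ⟨i, hi.trans_le hlen⟩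
        dsimp only at this
        rwa [List.getD_eq_getElem _ _ hi] at this
    refine ⟨c, hc, fun P hP => ?_, fun P hP => ?_⟩
    · have := hsign P (List.mem_flatMap.2 ⟨c, hc, List.mem_append_left _ hP⟩)
      rwa [sign_pos (hpos P hP), eq_comm, sign_eq_one_iff] at this
    · have := hsign P (List.mem_flatMap.2 ⟨c, hc, List.mem_append_right _ hP⟩)
      rwa [hzero P hP, sign_zero, eq_comm, sign_eq_zero_iff] at this

open Classical in
/-- Projections of presented sets have presentations of uniformly bounded degree. -/
theorem SAPres.exists_projection (D k l : ℕ) :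
    ∃ B, ∀ p : SAPres (k + l), p.deg = D →
      ∃ q : SAPres k, q.toSet = {y | ∃ v : Fin l → ℝ, Fin.append y v ∈ p.toSet} ∧ q.deg ≤ B := by
  let W := (Fin D → MvPolynomial (Fin (k + l)) ℝ) × Set (Fin D → SignType)
  let ev : W × (Fin k → ℝ) → MvPolynomial (Fin k) (W → ℝ) →+* ℝ :=
    mvPolyEval fun w => Pi.evalRingHom (fun _ : W => ℝ) w
  let s : Finset (Fin (k + l) →₀ ℕ) := Finset.Iic (Finsupp.equivFunOnFinite.symm fun _ => D)
  let t : Fin (k + l) → MvPolynomial (Fin l) (MvPolynomial (Fin k) (W → ℝ)) :=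
    Fin.append (fun j => C (X j)) X
  let G : Fin D → MvPolynomial (Fin l) (MvPolynomial (Fin k) (W → ℝ)) := fun i =>
    ∑ m ∈ s, C (C fun w => coeff m (w.1 i)) * ∏ j, t j ^ m j
  let I : (Fin D → SignType) → MvPolynomial (Fin l) (MvPolynomial (Fin k) (W → ℝ)) := fun σ =>
    C (C fun w => if σ ∈ w.2 then 1 else 0)
  have hI : ∀ z σ, 0 < mvPolyEval ev z (I σ) ↔ σ ∈ z.1.1.2 := by
    intro z σ
    simp only [I, ev, mvPolyEval, coe_eval₂Hom, eval₂_C, Pi.evalRingHom_apply]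
    split_ifs with h <;> simp [h]
  have ht : ∀ z j, mvPolyEval ev z (t j) = Fin.append z.1.2 z.2 j := by
    intro z j
    cases j using Fin.addCases <;> simp [t, ev, mvPolyEval]
  have hG : ∀ z i, (z.1.1.1 i).totalDegree ≤ D →
      mvPolyEval ev z (G i) = eval (Fin.append z.1.2 z.2) (z.1.1.1 i) := by
    intro z i hi
    rw [eval_eq']
    simp only [G, map_sum, map_mul, map_prod, map_pow, ht]
    symm
    refine Finset.sum_subset_zero_on_sdiff (fun m hm => ?_) (fun m hm => ?_) fun m _ => ?_
    · refine Finset.mem_Iic.2 fun j => ?_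
      exact (monomial_le_degreeOf j hm).trans ((degreeOf_le_totalDegree _ _).trans hi)
    · simp [ev, mvPolyEval, notMem_support_iff.1 (Finset.mem_sdiff.1 hm).2]
    · simp [ev, mvPolyEval]
  have htree : IsSignTree (mvPolyEval (σ := Fin l) ev) fun z =>
      (fun i => SignType.sign (mvPolyEval ev z (G i))) ∈ z.1.1.2 :=
    (IsSignTree.pi fun i => IsSignTree.sign _ (G i)).bind (g := fun σ z => σ ∈ z.1.1.2) fun σ =>
      (IsSignTree.pos _ (I σ)).congr fun z => propext (hI z σ)
  obtain ⟨N, B, hB⟩ := (IsSignTree.exists_fin htree).exists_presentation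
  refine ⟨B, ?_⟩
  rintro p rfl
  obtain ⟨Q, S, hQ, hp⟩ := p.exists_sign_condition
  obtain ⟨q, hq, -, hqB⟩ := hB (Q, S)
  refine ⟨q, ?_, hqB⟩
  rw [hq, hp]
  ext y
  simp only [mem_ofPred_eq]
  refine exists_congr fun v => ?_
  rw [funext fun i => congrArg SignType.sign (hG (((Q, S), y), v) i (hQ i))]

end Presentations

theorem exists_append_mem_graphSet_iff {k l : ℕ} {A : Set (Fin k → ℝ)}
    {f : (Fin k → ℝ) → (Fin l → ℝ)} {y : Fin k → ℝ} :
    (∃ v, Fin.append y v ∈ graphSet A f) ↔ y ∈ A := by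
  simp [graphSet]

/-- The domain of a semi-algebraic map is a semi-algebraic set, of degree bounded by a
function of the degree of the map and the ambient dimensions only. -/
theorem domain_of_semialgebraic_map :
    ∃ C : ℕ → ℕ → ℕ → ℕ,
      ∀ (k l : ℕ) (A : Set (Fin k → ℝ)) (f : (Fin k → ℝ) → (Fin l → ℝ)),
        IsSAMap A f →
        IsSemialgebraic A ∧ SADeg A ≤ C (SAMapDeg A f) k l := by
  choose C hC using SAPres.exists_projection
  refine ⟨C, fun k l A f hf => ?_⟩
  obtain ⟨p, hp : p.toSet = graphSet A f, hdeg⟩ := Nat.sInf_mem (Set.Nonempty.image SAPres.deg hf)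
  obtain ⟨q, hq, hqC⟩ := hC (SAMapDeg A f) k l p hdeg
  have hqA : q.toSet = A := by
    rw [hq, hp]
    ext y
    exact exists_append_mem_graphSet_iff
  exact ⟨⟨q, hqA⟩, (Nat.sInf_le (mem_image_of_mem SAPres.deg hqA)).trans hqC⟩
end

section
/- If φ and ψ are two semi-algebraic maps such that the composition φ ∘ ψ is well defined (the image of ψ is contained in the domain of φ), then φ ∘ ψ is a semi-algebraic map and deg(φ ∘ ψ) is bounded by a function of deg(φ) and deg(ψ) (and the ambient dimensions) only. -/
open Set

/-- `z` and `w` lie on the same side of each point of `T`. -/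
def SamePosition (T : Set ℝ) (z w : ℝ) : Prop := ∀ e ∈ T, (e < z ↔ e < w) ∧ (z < e ↔ w < e)

namespace SamePosition

variable {T : Set ℝ} {x y z w : ℝ}

theorem refl (T : Set ℝ) (z : ℝ) : SamePosition T z z := fun _ _ => ⟨Iff.rfl, Iff.rfl⟩

theorem symm (h : SamePosition T z w) : SamePosition T w z :=
  fun e he => ⟨(h e he).1.symm, (h e he).2.symm⟩

theorem trans (h : SamePosition T x y) (h' : SamePosition T y z) : SamePosition T x z :=
  fun e he => ⟨(h e he).1.trans (h' e he).1, (h e he).2.trans (h' e he).2⟩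

theorem of_between (hx : SamePosition T x w) (hy : SamePosition T y w) (hxz : x ≤ z)
    (hzy : z ≤ y) : SamePosition T z w := fun e he =>
  ⟨⟨fun h => (hy e he).1.1 (h.trans_le hzy), fun h => ((hx e he).1.2 h).trans_le hxz⟩,
    ⟨fun h => (hx e he).2.1 (hxz.trans_lt h), fun h => hzy.trans_lt ((hy e he).2.2 h)⟩⟩

theorem eq_of_mem (h : SamePosition T z w) (hw : w ∈ T) : z = w :=
  le_antisymm (not_lt.1 fun hl => lt_irrefl _ ((h w hw).1.1 hl))
    (not_lt.1 fun hl => lt_irrefl _ ((h w hw).2.1 hl))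

theorem of_no_point (hzw : z ≤ w) (h : ∀ e ∈ T, ¬ (z ≤ e ∧ e ≤ w)) : SamePosition T z w := by
  intro e he
  have := h e he
  constructor <;> constructor <;> intro h1 <;> grind

/-- A point strictly between `w` and its successor in `T`. -/
theorem of_lt_next {t : ℝ} (hw : w ∉ T) (hnext : ∀ s ∈ T, w < s → t ≤ s) (hwz : w ≤ z)
    (hzt : z < t) : SamePosition T z w := by
  refine (of_no_point hwz fun e he hh => ?_).symm
  rcases hh.1.eq_or_lt with h | h
  · exact hw (h ▸ he)
  · linarith [hnext e he h]

end SamePosition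

/-- A polynomial has constant sign on a component of the complement of a set containing its
roots. -/
theorem SamePosition.sign_eval_eq {T : Set ℝ} {q : Polynomial ℝ} {z w : ℝ}
    (hq : q ≠ 0 → ∀ x, q.eval x = 0 → x ∈ T) (h : SamePosition T z w) :
    SignType.sign (q.eval z) = SignType.sign (q.eval w) := by
  by_cases h0 : q = 0
  · simp [h0]
  replace hq := hq h0
  by_cases hw : w ∈ T
  · rw [h.eq_of_mem hw]
  have key : ∀ x, SamePosition T x w → q.eval x ≠ 0 := fun x hx hx0 =>
    hw ((hx.symm.eq_of_mem (hq x hx0)) ▸ hq x hx0)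
  have hpre : IsPreconnected {x | SamePosition T x w} := by
    refine Set.OrdConnected.isPreconnected ⟨fun x hx y hy u hu => ?_⟩
    exact SamePosition.of_between hx hy hu.1 hu.2
  have hcont : ContinuousOn (fun x => q.eval x) {x | SamePosition T x w} := q.continuousOn
  have hiv : ∀ x y, SamePosition T x w → SamePosition T y w → q.eval x < 0 → ¬ 0 < q.eval y := by
    intro x y hx hy hx0 hy0
    obtain ⟨u, hu, hu0⟩ := hpre.intermediate_value hx hy hcont ⟨hx0.le, hy0.le⟩
    exact key u hu hu0
  have hz0 := key z h
  have hw0 := key w (SamePosition.refl T w)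
  rcases lt_or_gt_of_ne hz0 with hz | hz <;> rcases lt_or_gt_of_ne hw0 with hws | hws
  · rw [sign_neg hz, sign_neg hws]
  · exact absurd hws (hiv z w h (.refl T w) hz)
  · exact absurd hz (hiv w z (.refl T w) h hws)
  · rw [sign_pos hz, sign_pos hws]

/-- An increasing polynomial is strictly monotone on a component. -/
theorem SamePosition.eval_lt_eval {T : Set ℝ} {q : Polynomial ℝ} {w x y : ℝ}
    (hder : ∀ z, SamePosition T z w → 0 < q.derivative.eval z)
    (hx : SamePosition T x w) (hy : SamePosition T y w) (hxy : x < y) :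
    q.eval x < q.eval y := by
  refine strictMonoOn_of_deriv_pos (convex_Icc x y) q.continuousOn (fun z hz => ?_)
    (left_mem_Icc.2 hxy.le) (right_mem_Icc.2 hxy.le) hxy
  rw [interior_Icc] at hz
  rw [Polynomial.deriv]
  exact hder z (SamePosition.of_between hx hy hz.1.le hz.2.le)

/-- A polynomial increasing on a component, and positive at the upper end of this component (if
there is one), takes positive values there. -/
theorem exists_samePosition_eval_pos {T : Set ℝ} (hT : T.Finite) {q : Polynomial ℝ} {w : ℝ}
    (hw : w ∉ T) (hder : ∀ z, SamePosition T z w → 0 < q.derivative.eval z)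
    (hend : ∀ t ∈ T, w < t → (∀ s ∈ T, w < s → t ≤ s) → 0 < q.eval t) :
    ∃ z, SamePosition T z w ∧ 0 < q.eval z := by
  by_cases hne : (T ∩ Ioi w).Nonempty
  · obtain ⟨t, ⟨htT, hwt⟩, htmin⟩ :=
      Set.exists_min_image (T ∩ Ioi w) id (hT.subset inter_subset_left) hne
    have hnext : ∀ s ∈ T, w < s → t ≤ s := fun s hs hws => htmin s ⟨hs, hws⟩
    have h1 : ∀ᶠ z in nhdsWithin t (Iio t), 0 < q.eval z :=
      (q.continuous.continuousAt.eventually (lt_mem_nhds (hend t htT hwt hnext))).filter_mono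
        nhdsWithin_le_nhds
    have h2 : ∀ᶠ z in nhdsWithin t (Iio t), z ∈ Ioo w t := Ioo_mem_nhdsLT hwt
    obtain ⟨z, hz, hz'⟩ := (h1.and h2).exists
    exact ⟨z, SamePosition.of_lt_next hw hnext hz'.1.le hz'.2, hz⟩
  · have hsame : ∀ z, w ≤ z → SamePosition T z w := fun z hz =>
      SamePosition.of_lt_next (t := z + 1) hw
        (fun s hs hws => absurd ⟨s, hs, hws⟩ hne) hz (lt_add_one z)
    by_contra! hcon
    have hle : q.degree ≤ 0 := by
      rw [← Polynomial.isBoundedUnder_abs_atTop_iff]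
      refine Filter.isBoundedUnder_of_eventually_le (a := |q.eval w|) ?_
      filter_upwards [Filter.eventually_gt_atTop w] with z hz
      have h1 := SamePosition.eval_lt_eval hder (.refl T w) (hsame z hz.le) hz
      have h2 := hcon z (hsame z hz.le)
      rw [abs_of_nonpos h2, abs_of_nonpos (h1.le.trans h2)]
      linarith
    have := hder w (.refl T w)
    rw [Polynomial.eq_C_of_degree_le_zero hle] at this
    simp at this

/-- A polynomial increasing on a component, and negative at the lower end of this component (if
there is one), takes negative values there. -/
theorem exists_samePosition_eval_neg {T : Set ℝ} (hT : T.Finite) {q : Polynomial ℝ} {w : ℝ}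
    (hw : w ∉ T) (hder : ∀ z, SamePosition T z w → 0 < q.derivative.eval z)
    (hend : ∀ t ∈ T, t < w → (∀ s ∈ T, s < w → s ≤ t) → q.eval t < 0) :
    ∃ z, SamePosition T z w ∧ q.eval z < 0 := by
  have hsame : ∀ z, SamePosition (Neg.neg '' T) z (-w) → SamePosition T (-z) w := by
    intro z hz e he
    have := hz (-e) ⟨e, he, rfl⟩
    constructor
    · rw [lt_neg, ← neg_lt_neg_iff (a := w), ← this.2]
    · rw [neg_lt, ← neg_lt_neg_iff (a := e), ← this.1]
  obtain ⟨z, hz, hz0⟩ := exists_samePosition_eval_pos (q := -q.comp (-Polynomial.X))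
    (hT.image Neg.neg) (w := -w) (by simpa using hw)
    (fun z hz => by simpa [Polynomial.derivative_comp] using hder (-z) (hsame z hz))
    (by
      rintro _ ⟨t, ht, rfl⟩ hwt hnext
      have := hend t ht (by linarith) fun s hs hsw => by
        linarith [hnext (-s) ⟨s, hs, rfl⟩ (by linarith)]
      simpa using this)
  exact ⟨-z, hsame z hz, by simpa using hz0⟩

/-- Let `h` match the finite sets `E` and `E'`, and let `p` and `q` be increasing on matching
components of their complements, with matching signs on `E` and `E'`. Then `p` and `q` take the
same signs on these components. -/
theorem exists_samePosition_sign_eq_of_derivative_pos {E E' : Set ℝ} (hE' : E'.Finite)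
    {p q : Polynomial ℝ} {h : ℝ → ℝ} (himg : h '' E = E')
    (hlt : ∀ e ∈ E, ∀ y, h y < h e ↔ y < e) (hgt : ∀ e ∈ E, ∀ y, h e < h y ↔ e < y)
    (hroot : ∀ e ∈ E, SignType.sign (p.eval e) = SignType.sign (q.eval (h e)))
    {y : ℝ} (hy : y ∉ E) (hp : ∀ z, SamePosition E z y → 0 < p.derivative.eval z)
    (hq : ∀ z, SamePosition E' z (h y) → 0 < q.derivative.eval z) :
    ∃ z, SamePosition E' z (h y) ∧ SignType.sign (q.eval z) = SignType.sign (p.eval y) := by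
  have hhy : h y ∉ E' := by
    rw [← himg]
    rintro ⟨e, he, hee⟩
    have h1 := (hlt e he y).not.1 hee.le.not_gt
    have h2 := (hgt e he y).not.1 hee.ge.not_gt
    exact hy (le_antisymm (not_lt.1 h1) (not_lt.1 h2) ▸ he)
  have hpos : 0 ≤ p.eval y → ∃ z, SamePosition E' z (h y) ∧ 0 < q.eval z := by
    intro h0
    refine exists_samePosition_eval_pos hE' hhy hq fun t ht hyt hnext => ?_
    obtain ⟨e, he, rfl⟩ := himg ▸ ht
    have hye := (hlt e he y).1 hyt
    have hne : ∀ s ∈ E, y < s → e ≤ s := fun s hs hys =>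
      not_lt.1 fun hse => (hnext (h s) (himg ▸ ⟨s, hs, rfl⟩) ((hlt s hs y).2 hys)).not_gt
        ((hgt s hs e).2 hse)
    have : p.eval y < p.eval e := by
      refine strictMonoOn_of_deriv_pos (convex_Icc y e) p.continuousOn (fun z hz => ?_)
        (left_mem_Icc.2 hye.le) (right_mem_Icc.2 hye.le) hye
      rw [interior_Icc] at hz
      rw [Polynomial.deriv]
      exact hp z (SamePosition.of_lt_next hy hne hz.1.le hz.2)
    have hs := hroot e he
    rw [sign_pos (h0.trans_lt this)] at hs
    exact sign_eq_one_iff.1 hs.symm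
  have hneg : p.eval y ≤ 0 → ∃ z, SamePosition E' z (h y) ∧ q.eval z < 0 := by
    intro h0
    refine exists_samePosition_eval_neg hE' hhy hq fun t ht hyt hnext => ?_
    obtain ⟨e, he, rfl⟩ := himg ▸ ht
    have hye := (hgt e he y).1 hyt
    have hne : ∀ s ∈ E, s < y → s ≤ e := fun s hs hys =>
      not_lt.1 fun hse => (hnext (h s) (himg ▸ ⟨s, hs, rfl⟩) ((hgt s hs y).2 hys)).not_gt
        ((hlt s hs e).2 hse)
    have : p.eval e < p.eval y := by
      refine strictMonoOn_of_deriv_pos (convex_Icc e y) p.continuousOn (fun z hz => ?_)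
        (left_mem_Icc.2 hye.le) (right_mem_Icc.2 hye.le) hye
      rw [interior_Icc] at hz
      rw [Polynomial.deriv]
      refine hp z (SamePosition.of_no_point hz.2.le fun s hs hsz => ?_)
      rcases hsz.2.eq_or_lt with hsy | hsy
      · exact hy (hsy ▸ hs)
      · linarith [hne s hs hsy, hz.1, hsz.1]
    have hs := hroot e he
    rw [sign_neg (this.trans_le h0)] at hs
    exact sign_eq_neg_one_iff.1 hs.symm
  rcases lt_trichotomy (p.eval y) 0 with h0 | h0 | h0
  · obtain ⟨z, hz, hz0⟩ := hneg h0.le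
    exact ⟨z, hz, by rw [sign_neg hz0, sign_neg h0]⟩
  · obtain ⟨z, hz, hz0⟩ := hneg h0.le
    obtain ⟨z', hz', hz0'⟩ := hpos h0.ge
    have hpre : IsPreconnected {x | SamePosition E' x (h y)} :=
      Set.OrdConnected.isPreconnected
        ⟨fun x hx y hy u hu => SamePosition.of_between hx hy hu.1 hu.2⟩
    obtain ⟨u, hu, hu0⟩ := hpre.intermediate_value hz hz' q.continuousOn ⟨hz0.le, hz0'.le⟩
    exact ⟨u, hu, h0 ▸ congrArg SignType.sign hu0⟩
  · obtain ⟨z, hz, hz0⟩ := hpos h0.le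
    exact ⟨z, hz, by rw [sign_pos hz0, sign_pos h0]⟩

/-- A monotone map preserving the signs of a nonzero polynomial is strictly monotone at its
roots. -/
theorem lt_iff_lt_of_root {P Q : Polynomial ℝ} {h : ℝ → ℝ} (hmono : Monotone h)
    (hs : ∀ y, SignType.sign (P.eval y) = SignType.sign (Q.eval (h y))) (hP : P ≠ 0)
    {e : ℝ} (he : P.eval e = 0) (y : ℝ) : (h y < h e ↔ y < e) ∧ (h e < h y ↔ e < y) := by
  have hex : ∀ u v, u < v → ∃ z ∈ Ioo u v, P.eval z ≠ 0 := by
    intro u v huv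
    by_contra! hcon
    exact hP (Polynomial.eq_zero_of_infinite_isRoot P
      ((Set.Ioo_infinite huv).mono fun z hz => hcon z hz))
  have hne : ∀ z, P.eval z ≠ 0 → h z ≠ h e := by
    intro z hz hze
    have h1 := hs z
    rw [hze, ← hs e, he, sign_zero, sign_eq_zero_iff] at h1
    exact hz h1
  refine ⟨⟨fun hl => not_le.1 fun h' => hl.not_ge (hmono h'), fun hl => ?_⟩,
    ⟨fun hl => not_le.1 fun h' => hl.not_ge (hmono h'), fun hl => ?_⟩⟩
  · obtain ⟨z, hz, hz0⟩ := hex _ _ hl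
    exact (hmono hz.1.le).trans_lt (lt_of_le_of_ne (hmono hz.2.le) (hne z hz0))
  · obtain ⟨z, hz, hz0⟩ := hex _ _ hl
    exact (lt_of_le_of_ne (hmono hz.1.le) (hne z hz0).symm).trans_le (hmono hz.2.le)

/-- The roots of the nonzero members of a family of polynomials. -/
def familyRoots {ι : Type*} (P : ι → Polynomial ℝ) : Set ℝ :=
  {y | ∃ i, P i ≠ 0 ∧ (P i).eval y = 0}

theorem finite_familyRoots {ι : Type*} [Finite ι] (P : ι → Polynomial ℝ) :
    (familyRoots P).Finite := by
  have : familyRoots P = ⋃ i, {y | P i ≠ 0 ∧ (P i).eval y = 0} := by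
    ext y
    simp [familyRoots]
  rw [this]
  refine Set.finite_iUnion fun i => ?_
  by_cases h : P i = 0
  · simp [h]
  · exact (Polynomial.finite_setOfPred_isRoot h).subset fun y hy => hy.2

theorem eq_zero_of_sign_eq {P Q : Polynomial ℝ} {h : ℝ → ℝ}
    (hs : ∀ y, SignType.sign (P.eval y) = SignType.sign (Q.eval (h y))) (hQ : Q = 0) :
    P = 0 :=
  Polynomial.funext fun y => by
    have := hs y
    rw [hQ] at this
    simpa using this

theorem image_familyRoots {ι : Type*} [Finite ι] {P Q : ι → Polynomial ℝ} {h h' : ℝ → ℝ}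
    (hmono : Monotone h) (hmono' : Monotone h')
    (hs : ∀ i y, SignType.sign ((P i).eval y) = SignType.sign ((Q i).eval (h y)))
    (hs' : ∀ i y, SignType.sign ((Q i).eval y) = SignType.sign ((P i).eval (h' y))) :
    h '' familyRoots P = familyRoots Q := by
  have hmaps : ∀ (P Q : ι → Polynomial ℝ) (h h' : ℝ → ℝ), Monotone h →
      (∀ i y, SignType.sign ((P i).eval y) = SignType.sign ((Q i).eval (h y))) →
      (∀ i y, SignType.sign ((Q i).eval y) = SignType.sign ((P i).eval (h' y))) →
      h '' familyRoots P ⊆ familyRoots Q ∧ InjOn h (familyRoots P) := by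
    intro P Q h h' hm hs hs'
    constructor
    · rintro _ ⟨y, ⟨i, hi, hiy⟩, rfl⟩
      refine ⟨i, fun h0 => hi (eq_zero_of_sign_eq (hs i) h0), ?_⟩
      have := hs i y
      rw [hiy, sign_zero] at this
      exact sign_eq_zero_iff.1 this.symm
    · rintro x - y ⟨i, hi, hiy⟩ hxy
      have := lt_iff_lt_of_root hm (hs i) hi hiy x
      exact le_antisymm (not_lt.1 fun hl => hxy.not_gt (this.2.2 hl))
        (not_lt.1 fun hl => hxy.not_lt (this.1.2 hl))
  obtain ⟨h1, h2⟩ := hmaps P Q h h' hmono hs hs'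
  obtain ⟨h1', h2'⟩ := hmaps Q P h' h hmono' hs' hs
  refine Set.eq_of_subset_of_ncard_le h1 ?_ (finite_familyRoots Q)
  rw [h2.ncard_image, ← h2'.ncard_image]
  exact Set.ncard_le_ncard h1' (finite_familyRoots P)

/-- Let `h`, `h'` be monotone maps preserving the signs of the families `P` and `Q`, which contain
the nonzero derivatives of `p` and `q`. If `h` also preserves the signs of `p` and `q` at the roots
of `P`, then some monotone map preserves the signs of `P`, `Q` and of `p`, `q`. -/
theorem exists_monotone_sign_eq {ι : Type*} [Finite ι] {P Q : ι → Polynomial ℝ} {h h' : ℝ → ℝ}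
    {p q : Polynomial ℝ} (hmono : Monotone h) (hmono' : Monotone h')
    (hs : ∀ i y, SignType.sign ((P i).eval y) = SignType.sign ((Q i).eval (h y)))
    (hs' : ∀ i y, SignType.sign ((Q i).eval y) = SignType.sign ((P i).eval (h' y)))
    {j : ι} (hPj : P j = p.derivative) (hQj : Q j = q.derivative) (hPj0 : P j ≠ 0)
    (hroot : ∀ i y, P i ≠ 0 → (P i).eval y = 0 →
      SignType.sign (p.eval y) = SignType.sign (q.eval (h y))) :
    ∃ H : ℝ → ℝ, Monotone H ∧
      (∀ i y, SignType.sign ((P i).eval y) = SignType.sign ((Q i).eval (H y))) ∧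
      ∀ y, SignType.sign (p.eval y) = SignType.sign (q.eval (H y)) := by
  set E := familyRoots P with hE
  set E' := familyRoots Q with hE'
  have himg : h '' E = E' := image_familyRoots hmono hmono' hs hs'
  have hfin : E'.Finite := finite_familyRoots Q
  have hlg : ∀ e ∈ E, ∀ y, (h y < h e ↔ y < e) ∧ (h e < h y ↔ e < y) := by
    rintro e ⟨i, hi, hie⟩ y
    exact lt_iff_lt_of_root hmono (hs i) hi hie y
  have hpos : ∀ {x y}, SamePosition E x y → SamePosition E' (h x) (h y) := by
    intro x y hxy e' he'
    obtain ⟨e, he, rfl⟩ := himg ▸ he'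
    rw [(hlg e he x).1, (hlg e he x).2, (hlg e he y).1, (hlg e he y).2]
    exact hxy e he
  have hrootE : ∀ e ∈ E, SignType.sign (p.eval e) = SignType.sign (q.eval (h e)) := by
    rintro e ⟨i, hi, hie⟩
    exact hroot i e hi hie
  have hsP : ∀ i {z w}, SamePosition E z w →
      SignType.sign ((P i).eval z) = SignType.sign ((P i).eval w) := fun i z w hzw =>
    SamePosition.sign_eval_eq (T := E) (fun h0 x hx => ⟨i, h0, hx⟩) hzw
  have hsQ : ∀ i {z w}, SamePosition E' z w →
      SignType.sign ((Q i).eval z) = SignType.sign ((Q i).eval w) := fun i z w hzw =>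
    SamePosition.sign_eval_eq (T := E') (fun h0 x hx => ⟨i, h0, hx⟩) hzw
  have hp_pos : ∀ y, 0 < p.derivative.eval y →
      (∀ z, SamePosition E z y → 0 < p.derivative.eval z) ∧
      (∀ z, SamePosition E' z (h y) → 0 < q.derivative.eval z) := by
    intro y hy
    rw [← hPj, ← hQj] at *
    constructor <;> intro z hz <;> rw [← sign_eq_one_iff]
    · rw [hsP j hz, sign_pos hy]
    · rw [hsQ j hz, ← hs, sign_pos hy]
  have hp_neg : ∀ y, p.derivative.eval y < 0 →
      (∀ z, SamePosition E z y → 0 < (-p).derivative.eval z) ∧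
      (∀ z, SamePosition E' z (h y) → 0 < (-q).derivative.eval z) := by
    intro y hy
    simp only [Polynomial.derivative_neg, Polynomial.eval_neg, Left.neg_pos_iff]
    rw [← hPj, ← hQj] at *
    constructor <;> intro z hz <;> rw [← sign_eq_neg_one_iff]
    · rw [hsP j hz, sign_neg hy]
    · rw [hsQ j hz, ← hs, sign_neg hy]
  have hp0 : ∀ y, y ∉ E → p.derivative.eval y ≠ 0 := fun y hy h0 =>
    hy ⟨j, hPj0, by rw [hPj, h0]⟩
  let K : ℝ → Set ℝ := fun y =>
    {z | SamePosition E' z (h y) ∧ SignType.sign (q.eval z) = SignType.sign (p.eval y)}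
  have hK : ∀ y, (K y).Nonempty := by
    intro y
    by_cases hy : y ∈ E
    · exact ⟨h y, .refl _ _, (hrootE y hy).symm⟩
    rcases lt_or_gt_of_ne (hp0 y hy) with h0 | h0
    · obtain ⟨h1, h2⟩ := hp_neg y h0
      obtain ⟨z, hz, hz0⟩ := exists_samePosition_sign_eq_of_derivative_pos hfin himg
        (fun e he y => (hlg e he y).1) (fun e he y => (hlg e he y).2)
        (fun e he => by simp [Left.sign_neg, hrootE e he]) hy h1 h2
      refine ⟨z, hz, ?_⟩
      simpa [Left.sign_neg] using hz0
    · obtain ⟨h1, h2⟩ := hp_pos y h0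
      exact exists_samePosition_sign_eq_of_derivative_pos hfin himg
        (fun e he y => (hlg e he y).1) (fun e he y => (hlg e he y).2) hrootE hy h1 h2
  let H : ℝ → ℝ := fun y => Classical.epsilon fun z => z ∈ K y
  have hH : ∀ y, H y ∈ K y := fun y => Classical.epsilon_spec (hK y)
  refine ⟨H, ?_, fun i y => by rw [hs, hsQ i (hH y).1], fun y => (hH y).2.symm⟩
  intro x y hxy
  by_cases hsep : ∃ e ∈ E, x ≤ e ∧ e ≤ y
  · obtain ⟨e, he, hxe, hey⟩ := hsep
    have he' : h e ∈ E' := himg ▸ ⟨e, he, rfl⟩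
    have h1 : H x ≤ h e := not_lt.1 fun hl =>
      (hmono hxe).not_gt ((((hH x).1 _ he').1).1 hl)
    have h2 : h e ≤ H y := not_lt.1 fun hl =>
      (hmono hey).not_gt ((((hH y).1 _ he').2).1 hl)
    exact h1.trans h2
  have hsame : SamePosition E x y := SamePosition.of_no_point hxy fun e he hh =>
    hsep ⟨e, he, hh⟩
  have hx : x ∉ E := fun hx => hsep ⟨x, hx, le_rfl, hxy⟩
  by_cases hsign : SignType.sign (p.eval x) = SignType.sign (p.eval y)
  · have : K x = K y := by
      ext z
      simp only [K, Set.mem_ofPred_eq, hsign]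
      exact and_congr_left fun _ => ⟨fun hz => hz.trans (hpos hsame),
        fun hz => hz.trans (hpos hsame).symm⟩
    exact (congrArg (fun s : Set ℝ => Classical.epsilon fun z => z ∈ s) this).le
  have hlt : x < y := lt_of_le_of_ne hxy fun hh => hsign (by rw [hh])
  by_contra! hHxy
  have hyx : SamePosition E' (H y) (h x) := (hH y).1.trans (hpos hsame).symm
  rcases lt_or_gt_of_ne (hp0 x hx) with h0 | h0
  · obtain ⟨h1, h2⟩ := hp_neg x h0
    have h3 := SamePosition.eval_lt_eval h1 (.refl _ _) hsame.symm hlt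
    have h4 := SamePosition.eval_lt_eval h2 hyx (hH x).1 hHxy
    simp only [Polynomial.eval_neg, neg_lt_neg_iff] at h3 h4
    have h5 := SignType.sign.monotone h3.le
    have h6 := SignType.sign.monotone h4.le
    rw [(hH x).2, (hH y).2] at h6
    exact hsign (le_antisymm h6 h5)
  · obtain ⟨h1, h2⟩ := hp_pos x h0
    have h3 := SamePosition.eval_lt_eval h1 (.refl _ _) hsame.symm hlt
    have h4 := SamePosition.eval_lt_eval h2 hyx (hH x).1 hHxy
    have h5 := SignType.sign.monotone h3.le
    have h6 := SignType.sign.monotone h4.le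
    rw [(hH x).2, (hH y).2] at h6
    exact hsign (le_antisymm h5 h6)

section SignDetermined

open Polynomial

variable {R : Type*} [CommRing R]

/-- The sign diagram of the specializations of `F` is determined by the signs of finitely many
coefficients in `R`. -/
def SignDetermined (F : Set R[X]) : Prop :=
  ∃ G : Set R, G.Finite ∧ ∀ a b : R →+* ℝ,
    (∀ g ∈ G, SignType.sign (a g) = SignType.sign (b g)) →
    ∃ h : ℝ → ℝ, Monotone h ∧ ∀ f ∈ F, ∀ y,
      SignType.sign ((f.map a).eval y) = SignType.sign ((f.map b).eval (h y))

theorem SignDetermined.insert_C {F : Set R[X]} (h : SignDetermined F) (r : R) :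
    SignDetermined (insert (C r) F) := by
  obtain ⟨G, hG, h⟩ := h
  refine ⟨insert r G, hG.insert r, fun a b hab => ?_⟩
  obtain ⟨h, hm, hs⟩ := h a b fun g hg => hab g (mem_insert_of_mem r hg)
  refine ⟨h, hm, ?_⟩
  rintro f (rfl | hf) y
  · simpa using hab r (mem_insert r G)
  · exact hs f hf y

/-- Pseudo-division, with an even power of the leading coefficient. -/
theorem exists_pseudo_division (g : R[X]) {n : ℕ} (hg : g.natDegree ≤ n) (hn : 0 < n)
    (f : R[X]) : ∃ (k : ℕ) (q r : R[X]),
      C (g.coeff n ^ (2 * k)) * f = q * g + r ∧ r.natDegree < n := by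
  induction hm : f.natDegree using Nat.strong_induction_on generalizing f with
  | _ m ih =>
    rcases lt_or_ge m n with hmn | hmn
    · exact ⟨0, 0, f, by simp, hm ▸ hmn⟩
    set f' := C (g.coeff n) * f - C (f.coeff m) * X ^ (m - n) * g with hf'
    have hdeg : f'.natDegree < m := by
      refine Nat.lt_of_le_pred (hn.trans_le hmn) (natDegree_le_iff_coeff_eq_zero.2 fun i hi => ?_)
      have hi' : m ≤ i := Nat.le_of_pred_lt hi
      have hc : (C (f.coeff m) * X ^ (m - n) * g).coeff i = f.coeff m * g.coeff (i - (m - n)) := by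
        rw [mul_assoc, coeff_C_mul, coeff_X_pow_mul', if_pos (by omega)]
      rw [hf', coeff_sub, coeff_C_mul, hc]
      rcases hi'.eq_or_lt with rfl | him
      · rw [Nat.sub_sub_self hmn]
        ring
      · rw [coeff_eq_zero_of_natDegree_lt (p := f) (n := i) (by omega),
          coeff_eq_zero_of_natDegree_lt (p := g) (n := i - (m - n)) (by omega)]
        ring
    obtain ⟨k, q, r, hqr, hr⟩ := ih _ hdeg f' rfl
    refine ⟨k + 1, C (g.coeff n) * q +
      C (g.coeff n ^ (2 * k) * g.coeff n * f.coeff m) * X ^ (m - n), C (g.coeff n) * r, ?_,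
      (natDegree_C_mul_le _ _).trans_lt hr⟩
    have h1 : C (g.coeff n ^ (2 * (k + 1))) * f =
        C (g.coeff n) * (C (g.coeff n ^ (2 * k)) * f') +
        C (g.coeff n ^ (2 * k) * g.coeff n * f.coeff m) * X ^ (m - n) * g := by
      rw [hf']
      simp only [C_mul, C_pow]
      ring
    rw [h1, hqr]
    ring

/-- The terms of degree at most `n` of a polynomial. -/
noncomputable def truncLE (n : ℕ) (g : R[X]) : R[X] :=
  ∑ i ∈ Finset.range (n + 1), C (g.coeff i) * X ^ i

theorem natDegree_truncLE_le (n : ℕ) (g : R[X]) : (truncLE n g).natDegree ≤ n := by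
  refine natDegree_sum_le_of_forall_le _ _ fun i hi => ?_
  exact (natDegree_C_mul_X_pow_le _ _).trans (by grind)

theorem coeff_truncLE_self (n : ℕ) (g : R[X]) : (truncLE n g).coeff n = g.coeff n := by
  simp [truncLE, coeff_X_pow]

theorem map_truncLE {a : R →+* ℝ} {g : R[X]} {n : ℕ} (h : (g.map a).natDegree = n) :
    (truncLE n g).map a = g.map a := by
  rw [(g.map a).as_sum_range_C_mul_X_pow, h, truncLE, Polynomial.map_sum]
  simp

theorem natDegree_map_eq {a b : R →+* ℝ} {g : R[X]}
    (h : ∀ i, SignType.sign (a (g.coeff i)) = SignType.sign (b (g.coeff i))) :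
    (g.map a).natDegree = (g.map b).natDegree := by
  have key : ∀ {a b : R →+* ℝ},
      (∀ i, SignType.sign (a (g.coeff i)) = SignType.sign (b (g.coeff i))) →
      (g.map a).natDegree ≤ (g.map b).natDegree := by
    intro a b h
    refine natDegree_le_iff_coeff_eq_zero.2 fun i hi => ?_
    have h1 : b (g.coeff i) = 0 := by
      rw [← coeff_map]
      exact coeff_eq_zero_of_natDegree_lt hi
    have h2 := h i
    rw [h1, sign_zero, sign_eq_zero_iff] at h2
    rw [coeff_map, h2]
  exact le_antisymm (key h) (key fun i => (h i).symm)

theorem sign_pow_two_mul_mul {c : ℝ} (hc : c ≠ 0) (k : ℕ) (x : ℝ) :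
    SignType.sign (c ^ (2 * k) * x) = SignType.sign x := by
  rw [sign_mul, sign_pos ((even_two_mul k).pow_pos hc), one_mul]

/-- Sign diagrams can be extended to a polynomial `f`, given those of its derivative, its
truncation, and its pseudo-remainders. -/
theorem SignDetermined.insert {F F' : Set R[X]} {f : R[X]} (hF : F.Finite)
    (hFF' : F ⊆ F') (hder : derivative f ∈ F') (herase : f.eraseLead ∈ F')
    (hf : 0 < f.natDegree)
    (hrem : ∀ g ∈ Insert.insert (derivative f) F, ∀ n, 0 < n → n ≤ g.natDegree →
      ∃ r ∈ F', ∃ (k : ℕ) (q : R[X]), C (g.coeff n ^ (2 * k)) * f = q * truncLE n g + r)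
    (h : SignDetermined F') : SignDetermined (Insert.insert f F) := by
  obtain ⟨G, hG, h⟩ := h
  set P := Insert.insert (derivative f) F with hP
  have hPfin : P.Finite := hF.insert _
  have hPF' : P ⊆ F' := Set.insert_subset hder hFF'
  refine ⟨Insert.insert f.leadingCoeff (G ∪ ⋃ g ∈ P, (g.coeffs : Set R)),
    (hG.union (hPfin.biUnion fun g _ => g.coeffs.finite_toSet)).insert _, fun a b hab => ?_⟩
  have habG : ∀ g ∈ G, SignType.sign (a g) = SignType.sign (b g) := fun g hg =>
    hab g (Or.inr (Or.inl hg))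
  have hcoeff : ∀ g ∈ P, ∀ i,
      SignType.sign (a (g.coeff i)) = SignType.sign (b (g.coeff i)) := by
    intro g hg i
    by_cases h0 : g.coeff i = 0
    · simp [h0]
    · exact hab _ (Or.inr (Or.inr (Set.mem_biUnion hg (coeff_mem_coeffs h0))))
  have hlead := hab f.leadingCoeff (Or.inl rfl)
  obtain ⟨φ, hφ, hs⟩ := h a b habG
  obtain ⟨φ', hφ', hs'⟩ := h b a fun g hg => (habG g hg).symm
  by_cases ha : a f.leadingCoeff = 0
  · have hb : b f.leadingCoeff = 0 := by
      rw [ha, sign_zero] at hlead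
      exact sign_eq_zero_iff.1 hlead.symm
    have hmap : ∀ c : R →+* ℝ, c f.leadingCoeff = 0 → f.map c = f.eraseLead.map c := by
      intro c hc
      conv_lhs => rw [← f.eraseLead_add_monomial_natDegree_leadingCoeff]
      rw [Polynomial.map_add, map_monomial, hc, monomial_zero_right, add_zero]
    refine ⟨φ, hφ, ?_⟩
    rintro g (rfl | hg) y
    · rw [hmap a ha, hmap b hb]
      exact hs _ herase y
    · exact hs g (hFF' hg) y
  have : Finite P := hPfin
  have hder0 : (derivative f).map a ≠ 0 := by
    intro h0
    have : ((derivative f).map a).coeff (f.natDegree - 1) = 0 := by rw [h0, coeff_zero]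
    rw [coeff_map, coeff_derivative, Nat.sub_add_cancel hf, map_mul] at this
    rcases mul_eq_zero.1 this with h1 | h1
    · exact ha h1
    · rw [map_add, map_natCast, map_one] at h1
      exact (Nat.cast_add_one_pos (f.natDegree - 1)).ne' h1
  have hroot : ∀ (g : P) (y : ℝ), g.1.map a ≠ 0 → (g.1.map a).eval y = 0 →
      SignType.sign ((f.map a).eval y) = SignType.sign ((f.map b).eval (φ y)) := by
    rintro ⟨g, hg⟩ y hg0 hgy
    simp only at hg0 hgy
    have hn0 : 0 < (g.map a).natDegree := by
      by_contra hn
      rw [eq_C_of_natDegree_eq_zero (Nat.eq_zero_of_not_pos hn), eval_C] at hgy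
      refine hg0 ?_
      rw [eq_C_of_natDegree_eq_zero (Nat.eq_zero_of_not_pos hn), hgy, C_0]
    obtain ⟨r, hr, k, q, hdiv⟩ := hrem g hg _ hn0 natDegree_map_le
    have hdeg := natDegree_map_eq (hcoeff g hg)
    have hca : a (g.coeff (g.map a).natDegree) ≠ 0 := by
      rw [← coeff_map]
      exact leadingCoeff_ne_zero.2 hg0
    have hcb : b (g.coeff (g.map a).natDegree) ≠ 0 := by
      intro h0
      have := hcoeff g hg (g.map a).natDegree
      rw [h0, sign_zero, sign_eq_zero_iff] at this
      exact hca this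
    have hgy' : (g.map b).eval (φ y) = 0 := by
      have := hs g (hPF' hg) y
      rw [hgy, sign_zero] at this
      exact sign_eq_zero_iff.1 this.symm
    have key : ∀ (c : R →+* ℝ) (z : ℝ), (g.map c).natDegree = (g.map a).natDegree →
        c (g.coeff (g.map a).natDegree) ≠ 0 → (g.map c).eval z = 0 →
        SignType.sign ((f.map c).eval z) = SignType.sign ((r.map c).eval z) := by
      intro c z hcd hc0 hz
      have h1 := congrArg (fun u => (u.map c).eval z) hdiv
      simp only [Polynomial.map_mul, Polynomial.map_add, map_C, eval_mul, eval_add, eval_C,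
        map_truncLE hcd, hz, mul_zero, zero_add] at h1
      rw [← h1, map_pow, sign_pow_two_mul_mul hc0]
    rw [key a y rfl hca hgy, key b (φ y) hdeg.symm hcb hgy']
    exact hs r hr y
  obtain ⟨H, hH, hHP, hHf⟩ := exists_monotone_sign_eq (p := f.map a) (q := f.map b)
    (P := fun g : P => g.1.map a) (Q := fun g : P => g.1.map b) hφ hφ'
    (fun g => hs _ (hPF' g.2)) (fun g => hs' _ (hPF' g.2))
    (j := ⟨derivative f, Set.mem_insert _ _⟩) (derivative_map f a).symm (derivative_map f b).symm
    hder0 hroot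
  refine ⟨H, hH, ?_⟩
  rintro g (rfl | hg) y
  · exact hHf y
  · exact hHP ⟨g, Set.mem_insert_of_mem _ hg⟩ y

theorem signDetermined_of_natDegree_lt (d : ℕ) : ∀ F : Set R[X], F.Finite →
    (∀ f ∈ F, f.natDegree < d) → SignDetermined F := by
  induction d with
  | zero =>
    intro F _ hF
    exact ⟨∅, Set.finite_empty, fun a b _ => ⟨id, monotone_id, fun f hf =>
      absurd (hF f hf) (Nat.not_lt_zero _)⟩⟩
  | succ d ih =>
    have key : ∀ D : Set R[X], D.Finite → (∀ f ∈ D, f.natDegree = d) →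
        ∀ L : Set R[X], L.Finite → (∀ f ∈ L, f.natDegree < d) → SignDetermined (D ∪ L) := by
      intro D hD
      induction D, hD using Set.Finite.induction_on with
      | empty =>
        intro _ L hL hLd
        simpa using ih L hL hLd
      | @insert f D hfD hD ihD =>
        intro hDd L hL hLd
        have hfd : f.natDegree = d := hDd f (Set.mem_insert _ _)
        have hDd' : ∀ g ∈ D, g.natDegree = d := fun g hg => hDd g (Set.mem_insert_of_mem _ hg)
        rw [Set.insert_union]
        rcases Nat.eq_zero_or_pos d with hd | hd
        · rw [eq_C_of_natDegree_eq_zero (hfd.trans hd)]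
          exact (ihD hDd' L hL hLd).insert_C _
        have hder : (derivative f).natDegree < d := hfd ▸ natDegree_derivative_lt (by grind)
        set P := Insert.insert (derivative f) (D ∪ L)
        have hPfin : P.Finite := (hD.union hL).insert _
        have hPd : ∀ g ∈ P, g.natDegree ≤ d := by
          rintro g (rfl | hg | hg)
          · exact hder.le
          · exact (hDd' g hg).le
          · exact (hLd g hg).le
        have hrem : ∀ (g : R[X]) (n : ℕ), ∃ r : R[X], 0 < n →
            r.natDegree < n ∧ ∃ (k : ℕ) (q : R[X]),
              C (g.coeff n ^ (2 * k)) * f = q * truncLE n g + r := by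
          intro g n
          rcases Nat.eq_zero_or_pos n with rfl | hn
          · exact ⟨0, fun h => absurd h (lt_irrefl _)⟩
          obtain ⟨k, q, r, hqr, hr⟩ :=
            exists_pseudo_division (truncLE n g) (natDegree_truncLE_le n g) hn f
          rw [coeff_truncLE_self] at hqr
          exact ⟨r, fun _ => ⟨hr, k, q, hqr⟩⟩
        choose r hr using hrem
        set L' := L ∪ {derivative f, f.eraseLead} ∪
          (fun x : R[X] × ℕ => r x.1 x.2) '' (P ×ˢ Set.Icc 1 d) with hL'
        refine SignDetermined.insert (F' := D ∪ L') (hD.union hL) ?_ ?_ ?_ (hfd ▸ hd) ?_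
          (ihD hDd' L' ?_ ?_)
        · exact Set.union_subset_union_right D fun g hg => Or.inl (Or.inl hg)
        · exact Or.inr (Or.inl (Or.inr (Or.inl rfl)))
        · exact Or.inr (Or.inl (Or.inr (Or.inr rfl)))
        · intro g hg n hn hng
          exact ⟨r g n, Or.inr (Or.inr ⟨(g, n), ⟨hg, hn, hng.trans (hPd g hg)⟩, rfl⟩),
            (hr g n hn).2⟩
        · exact (hL.union (Set.toFinite _)).union ((hPfin.prod (Set.finite_Icc 1 d)).image _)
        · rintro g ((hg | rfl | rfl) | ⟨⟨g, n⟩, ⟨hg, hn1, hnd⟩, rfl⟩)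
          · exact hLd g hg
          · exact hder
          · have := f.eraseLead_natDegree_le
            grind
          · exact (hr g n hn1).1.trans_le hnd
    intro F hF hFd
    have : F = {f ∈ F | f.natDegree = d} ∪ {f ∈ F | f.natDegree < d} := by
      ext f
      have := hFd f
      simp only [Set.mem_union, Set.mem_ofPred_eq]
      grind
    rw [this]
    exact key _ (hF.subset (Set.sep_subset _ _)) (fun f hf => hf.2) _
      (hF.subset (Set.sep_subset _ _)) fun f hf => hf.2

theorem Set.Finite.signDetermined {F : Set R[X]} (hF : F.Finite) : SignDetermined F := by
  obtain ⟨d, hd⟩ := (hF.image natDegree).bddAbove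
  exact signDetermined_of_natDegree_lt (d + 1) F hF fun f hf =>
    Nat.lt_succ_of_le (hd (Set.mem_image_of_mem _ hf))

end SignDetermined

section Elimination

open MvPolynomial

theorem exists_finite_sign_elim_option {σ : Type} {G : Set (MvPolynomial (Option σ) ℝ)}
    (hG : G.Finite) : ∃ G' : Set (MvPolynomial σ ℝ), G'.Finite ∧ ∀ x x' : σ → ℝ,
      (∀ g ∈ G', SignType.sign (eval x g) = SignType.sign (eval x' g)) → ∀ y, ∃ y', ∀ g ∈ G,
        SignType.sign (eval (fun i => Option.elim i y x) g) =
          SignType.sign (eval (fun i => Option.elim i y' x') g) := by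
  obtain ⟨G', hG', h⟩ := (hG.image (optionEquivLeft ℝ σ)).signDetermined
  refine ⟨G', hG', fun x x' hx y => ?_⟩
  obtain ⟨f, -, hf⟩ := h (eval x) (eval x') hx
  refine ⟨f y, fun g hg => ?_⟩
  rw [optionEquivLeft_elim_eval, optionEquivLeft_elim_eval]
  exact hf _ (Set.mem_image_of_mem _ hg) y

/-- Elimination of finitely many variables: the signs of finitely many polynomials at `x`
determine which signs the members of `G` take on the fibre over `x`. -/
theorem exists_finite_sign_elim (m : ℕ) : ∀ {σ : Type} {G : Set (MvPolynomial (σ ⊕ Fin m) ℝ)},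
    G.Finite → ∃ G' : Set (MvPolynomial σ ℝ), G'.Finite ∧ ∀ x x' : σ → ℝ,
      (∀ g ∈ G', SignType.sign (eval x g) = SignType.sign (eval x' g)) →
      ∀ y : Fin m → ℝ, ∃ y' : Fin m → ℝ, ∀ g ∈ G,
        SignType.sign (eval (Sum.elim x y) g) = SignType.sign (eval (Sum.elim x' y') g) := by
  induction m with
  | zero =>
    intro σ G hG
    have hren : ∀ (x : σ → ℝ) (y : Fin 0 → ℝ) (g : MvPolynomial (σ ⊕ Fin 0) ℝ),
        eval (Sum.elim x y) g = eval x (rename (Sum.elim id Fin.elim0) g) := by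
      intro x y g
      rw [eval_rename]
      congr 2
      funext i
      rcases i with i | i
      · rfl
      · exact i.elim0
    refine ⟨_, hG.image (rename (Sum.elim id Fin.elim0)), fun x x' hx y => ⟨y, fun g hg => ?_⟩⟩
    rw [hren, hren]
    exact hx _ (Set.mem_image_of_mem _ hg)
  | succ m ih =>
    intro σ G hG
    let e : σ ⊕ Fin (m + 1) → Option σ ⊕ Fin m :=
      Sum.elim (fun i => Sum.inl (some i)) (Fin.cases (Sum.inl none) Sum.inr)
    have hren : ∀ (x : σ → ℝ) (y : ℝ) (z : Fin m → ℝ) (g : MvPolynomial (σ ⊕ Fin (m + 1)) ℝ),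
        eval (Sum.elim (fun i => Option.elim i y x) z) (rename e g) =
          eval (Sum.elim x (Fin.cons y z : Fin (m + 1) → ℝ)) g := by
      intro x y z g
      rw [eval_rename]
      congr 2
      funext i
      rcases i with i | i
      · rfl
      · refine Fin.cases ?_ (fun i => ?_) i <;> simp [e]
    obtain ⟨G₁, hG₁, h₁⟩ := ih (hG.image (rename e))
    obtain ⟨G₂, hG₂, h₂⟩ := exists_finite_sign_elim_option hG₁
    refine ⟨G₂, hG₂, fun x x' hx y => ?_⟩
    obtain ⟨y₀, hy₀⟩ := h₂ x x' hx (y 0)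
    obtain ⟨z, hz⟩ := h₁ _ _ hy₀ (Fin.tail y)
    refine ⟨Fin.cons y₀ z, fun g hg => ?_⟩
    have := hz _ (Set.mem_image_of_mem _ hg)
    rwa [hren, hren, Fin.cons_self_tail] at this

end Elimination

section UniformDegree

open MvPolynomial

theorem SAPres.exists_sign_family {d D : ℕ} (p : SAPres d) (hp : p.deg ≤ D) :
    ∃ P : Fin D → MvPolynomial (Fin d) ℝ, (∀ j, (P j).totalDegree ≤ D) ∧ ∀ x x',
      (∀ j, SignType.sign (eval x (P j)) = SignType.sign (eval x' (P j))) →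
      x ∈ p.toSet → x' ∈ p.toSet := by
  set l := p.flatMap fun c => c.1 ++ c.2 with hl
  have hsum : (l.map totalDegree).sum = p.deg := by
    simp [hl, SAPres.deg, List.flatMap_def, List.sum_flatten, List.map_flatten, Function.comp_def]
  set l' := l.filter fun Q => 0 < Q.totalDegree with hl'
  have hlen : ∀ l : List (MvPolynomial (Fin d) ℝ),
      (l.filter fun Q => 0 < Q.totalDegree).length ≤ (l.map totalDegree).sum := by
    intro l
    induction l with
    | nil => simp
    | cons Q l ih =>
      rw [List.filter_cons, List.map_cons, List.sum_cons]
      split_ifs with h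
      · simp only [decide_eq_true_eq] at h
        rw [List.length_cons]
        omega
      · omega
  have hlenD : l'.length ≤ D := (hlen l).trans (hsum.trans_le hp)
  refine ⟨fun j => l'.getD j 0, fun j => ?_, fun x x' h hx => ?_⟩
  · beta_reduce
    rcases lt_or_ge (j : ℕ) l'.length with hj | hj
    · rw [List.getD_eq_getElem _ _ hj]
      have hmem : l'[(j : ℕ)] ∈ l := (List.mem_filter.1 (List.getElem_mem hj)).1
      exact (List.le_sum_of_mem (List.mem_map_of_mem hmem)).trans (hsum.trans_le hp)
    · rw [List.getD_eq_default _ _ hj]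
      simp
  have key : ∀ Q ∈ l, SignType.sign (eval x Q) = SignType.sign (eval x' Q) := by
    intro Q hQ
    rcases Nat.eq_zero_or_pos Q.totalDegree with h0 | h0
    · rw [totalDegree_eq_zero_iff_eq_C.1 h0, eval_C, eval_C]
    · have hQ' : Q ∈ l' := List.mem_filter.2 ⟨hQ, by simpa using h0⟩
      obtain ⟨i, hi, rfl⟩ := List.getElem_of_mem hQ'
      have := h ⟨i, hi.trans_le hlenD⟩
      beta_reduce at this
      rwa [List.getD_eq_getElem _ _ hi] at this
  obtain ⟨c, hc, h1, h2⟩ := hx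
  refine ⟨c, hc, fun Q hQ => ?_, fun Q hQ => ?_⟩
  · rw [← sign_eq_one_iff, ← key Q (List.mem_flatMap.2 ⟨c, hc, List.mem_append_left _ hQ⟩)]
    exact sign_pos (h1 Q hQ)
  · rw [← sign_eq_zero_iff, ← key Q (List.mem_flatMap.2 ⟨c, hc, List.mem_append_right _ hQ⟩),
      h2 Q hQ, sign_zero]

theorem IsSemialgebraic.exists_sign_family {d D : ℕ} {A : Set (Fin d → ℝ)}
    (hA : IsSemialgebraic A) (hD : SADeg A ≤ D) :
    ∃ P : Fin D → MvPolynomial (Fin d) ℝ, (∀ j, (P j).totalDegree ≤ D) ∧ ∀ x x',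
      (∀ j, SignType.sign (eval x (P j)) = SignType.sign (eval x' (P j))) →
      x ∈ A → x' ∈ A := by
  obtain ⟨p, hp⟩ := hA
  obtain ⟨q, rfl, hq⟩ := Nat.sInf_mem (s := SAPres.deg '' {p : SAPres d | p.toSet = A})
    ⟨_, p, hp, rfl⟩
  exact q.exists_sign_family (hq.trans_le hD)

/-- The clause requiring each `g i` to have the sign `s i`. -/
noncomputable def signClause {ι : Type*} [Fintype ι] {d : ℕ} (g : ι → MvPolynomial (Fin d) ℝ)
    (s : ι → SignType) : List (MvPolynomial (Fin d) ℝ) × List (MvPolynomial (Fin d) ℝ) :=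
  (((Finset.univ.filter fun i => s i ≠ 0).toList.map fun i => C (s i : ℝ) * g i),
    ((Finset.univ.filter fun i => s i = 0).toList.map g))

theorem signClause_iff {ι : Type*} [Fintype ι] {d : ℕ} (g : ι → MvPolynomial (Fin d) ℝ)
    (s : ι → SignType) (x : Fin d → ℝ) :
    ((∀ P ∈ (signClause g s).1, 0 < eval x P) ∧ ∀ P ∈ (signClause g s).2, eval x P = 0) ↔
      ∀ i, SignType.sign (eval x (g i)) = s i := by
  simp only [signClause, List.mem_map, Finset.mem_toList, Finset.mem_filter, Finset.mem_univ,
    true_and, forall_exists_index, and_imp, forall_apply_eq_imp_iff₂, eval_mul, eval_C]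
  rw [← forall_and]
  refine forall_congr' fun i => ?_
  rcases h : s i <;> simp [sign_eq_one_iff, sign_eq_neg_one_iff]

theorem signClause_degree_le {ι : Type*} [Fintype ι] {d : ℕ} (g : ι → MvPolynomial (Fin d) ℝ)
    (s : ι → SignType) :
    ((signClause g s).1.map totalDegree).sum + ((signClause g s).2.map totalDegree).sum ≤
      ∑ i, (g i).totalDegree := by
  simp only [signClause, List.map_map, Function.comp_def, Finset.sum_map_toList]
  rw [← Finset.sum_filter_not_add_sum_filter Finset.univ (fun i => s i = 0)]
  refine Nat.add_le_add_right (Finset.sum_le_sum fun i _ => ?_) _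
  refine (totalDegree_mul _ _).trans ?_
  simp

/-- A set determined by the signs of finitely many polynomials is semi-algebraic. -/
theorem isSemialgebraic_of_sign {ι : Type*} [Fintype ι] {d : ℕ}
    (g : ι → MvPolynomial (Fin d) ℝ) {A : Set (Fin d → ℝ)}
    (hA : ∀ x x', (∀ i, SignType.sign (eval x (g i)) = SignType.sign (eval x' (g i))) →
      x ∈ A → x' ∈ A) :
    IsSemialgebraic A ∧ SADeg A ≤ Nat.card (ι → SignType) * ∑ i, (g i).totalDegree := by
  classical
  let S : Finset (ι → SignType) := Finset.univ.filter fun s =>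
    ∃ x ∈ A, ∀ i, SignType.sign (eval x (g i)) = s i
  let p : SAPres d := S.toList.map (signClause g)
  have hp : p.toSet = A := by
    ext x
    simp only [SAPres.toSet, Set.mem_ofPred_eq, p, List.mem_map, Finset.mem_toList]
    constructor
    · rintro ⟨_, ⟨s, hs, rfl⟩, h⟩
      rw [signClause_iff] at h
      obtain ⟨x', hx', hs'⟩ := (Finset.mem_filter.1 hs).2
      exact hA x' x (fun i => (hs' i).trans (h i).symm) hx'
    · intro hx
      exact ⟨_, ⟨fun i => SignType.sign (eval x (g i)),
        Finset.mem_filter.2 ⟨Finset.mem_univ _, x, hx, fun _ => rfl⟩, rfl⟩,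
        (signClause_iff g _ x).2 fun _ => rfl⟩
  have hdeg : SADeg A ≤ p.deg := Nat.sInf_le ⟨p, hp, rfl⟩
  refine ⟨⟨p, hp⟩, hdeg.trans ?_⟩
  rw [SAPres.deg, List.map_map]
  refine (List.sum_le_card_nsmul _ (∑ i, (g i).totalDegree) ?_).trans ?_
  · simp only [List.mem_map]
    rintro _ ⟨s, -, rfl⟩
    exact signClause_degree_le g s
  · rw [smul_eq_mul, List.length_map, Finset.length_toList, Nat.card_eq_fintype_card]
    exact Nat.mul_le_mul_right _ (Finset.card_le_univ S)

/-- The polynomial in `n` variables of degree at most `D` in each of them, with indeterminate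
coefficients. -/
noncomputable def universalPoly (n D : ℕ) : MvPolynomial ((Fin n → Fin (D + 1)) ⊕ Fin n) ℝ :=
  ∑ μ, X (Sum.inl μ) * ∏ i, X (Sum.inr i) ^ (μ i : ℕ)

theorem eval_universalPoly {n D : ℕ} {P : MvPolynomial (Fin n) ℝ} (hP : P.totalDegree ≤ D)
    (v : Fin n → ℝ) :
    eval (Sum.elim
      (fun μ => P.coeff (Finsupp.equivFunOnFinite.symm fun i => ((μ i : Fin (D + 1)) : ℕ))) v)
      (universalPoly n D) = eval v P := by
  let e : (Fin n → Fin (D + 1)) → Fin n →₀ ℕ := fun μ =>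
    Finsupp.equivFunOnFinite.symm fun i => (μ i : ℕ)
  have he : Function.Injective e := by
    intro μ ν h
    funext i
    exact Fin.ext (DFunLike.congr_fun h i)
  have hsub : P.support ⊆ Finset.univ.image e := by
    intro s hs
    have hsD : ∀ i, s i < D + 1 := fun i => Nat.lt_succ_of_le <|
      ((Finsupp.le_degree i s).trans (le_totalDegree hs)).trans hP
    exact Finset.mem_image.2 ⟨fun i => ⟨s i, hsD i⟩, Finset.mem_univ _, by ext; simp [e]⟩
  rw [eval_eq' v P, Finset.sum_subset hsub fun s _ hs => by
    rw [notMem_support_iff.1 hs, zero_mul], Finset.sum_image he.injOn]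
  simp [universalPoly, e]

/-- Substitution of real numbers for some of the variables. -/
noncomputable def specialize {τ σ : Type*} (c : τ → ℝ) :
    MvPolynomial (τ ⊕ σ) ℝ →ₐ[ℝ] MvPolynomial σ ℝ :=
  aeval (Sum.elim (fun t => C (c t)) X)

theorem eval_specialize {τ σ : Type*} (c : τ → ℝ) (x : σ → ℝ) (g : MvPolynomial (τ ⊕ σ) ℝ) :
    eval x (specialize c g) = eval (Sum.elim c x) g := by
  induction g using MvPolynomial.induction_on with
  | C a => simp [specialize]
  | add p q hp hq => simp [hp, hq]
  | mul_X p i hp => rcases i with i | i <;> simp_all [specialize]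

theorem totalDegree_specialize_le {τ σ : Type*} (c : τ → ℝ) (g : MvPolynomial (τ ⊕ σ) ℝ) :
    (specialize c g).totalDegree ≤ g.totalDegree := by
  rw [specialize, aeval_def, eval₂_eq]
  refine totalDegree_finsetSum_le fun s hs => ?_
  refine (totalDegree_mul _ _).trans ?_
  rw [algebraMap_eq, totalDegree_C, zero_add]
  refine (totalDegree_finsetProd _ _).trans (le_trans ?_ (le_totalDegree hs))
  refine Finset.sum_le_sum fun i _ => (totalDegree_pow _ _).trans ?_
  rcases i with i | i <;> simp

/-- The composition of two relations. -/
def relComp {k m p : ℕ} (S : Set (Fin (k + m) → ℝ)) (T : Set (Fin (m + p) → ℝ)) :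
    Set (Fin (k + p) → ℝ) :=
  {z | ∃ y : Fin m → ℝ, Fin.append (fun i => z (Fin.castAdd p i)) y ∈ S ∧
    Fin.append y (fun i => z (Fin.natAdd k i)) ∈ T}

theorem exists_relComp_bound (D₁ D₂ k m p : ℕ) :
    ∃ N : ℕ, ∀ (S : Set (Fin (k + m) → ℝ)) (T : Set (Fin (m + p) → ℝ)),
      IsSemialgebraic S → IsSemialgebraic T → SADeg S ≤ D₁ → SADeg T ≤ D₂ →
      IsSemialgebraic (relComp S T) ∧ SADeg (relComp S T) ≤ N := by
  let τ := (Fin D₁ × (Fin (k + m) → Fin (D₁ + 1))) ⊕ (Fin D₂ × (Fin (m + p) → Fin (D₂ + 1)))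
  let U : Fin D₁ → MvPolynomial ((τ ⊕ Fin (k + p)) ⊕ Fin m) ℝ := fun j =>
    rename (Sum.elim (fun μ => Sum.inl (Sum.inl (Sum.inl (j, μ))))
      (Fin.append (fun i => Sum.inl (Sum.inr (Fin.castAdd p i))) Sum.inr))
      (universalPoly (k + m) D₁)
  let V : Fin D₂ → MvPolynomial ((τ ⊕ Fin (k + p)) ⊕ Fin m) ℝ := fun j =>
    rename (Sum.elim (fun μ => Sum.inl (Sum.inl (Sum.inr (j, μ))))
      (Fin.append Sum.inr (fun i => Sum.inl (Sum.inr (Fin.natAdd k i)))))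
      (universalPoly (m + p) D₂)
  have hU : ∀ c₁ c₂ z y j, eval (Sum.elim (Sum.elim (Sum.elim c₁ c₂) z) y) (U j) =
      eval (Sum.elim (fun μ => c₁ (j, μ)) (Fin.append (fun i => z (Fin.castAdd p i)) y))
        (universalPoly (k + m) D₁) := by
    intro c₁ c₂ z y j
    rw [eval_rename]
    congr 2
    funext i
    rcases i with i | i
    · rfl
    · refine Fin.addCases (fun i => ?_) (fun i => ?_) i <;> simp
  have hV : ∀ c₁ c₂ z y j, eval (Sum.elim (Sum.elim (Sum.elim c₁ c₂) z) y) (V j) =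
      eval (Sum.elim (fun μ => c₂ (j, μ)) (Fin.append y (fun i => z (Fin.natAdd k i))))
        (universalPoly (m + p) D₂) := by
    intro c₁ c₂ z y j
    rw [eval_rename]
    congr 2
    funext i
    rcases i with i | i
    · rfl
    · refine Fin.addCases (fun i => ?_) (fun i => ?_) i <;> simp
  obtain ⟨G, hG, h⟩ := exists_finite_sign_elim m
    ((Set.finite_range U).union (Set.finite_range V))
  have : Fintype G := hG.fintype
  refine ⟨Nat.card (G → SignType) * ∑ g : G, g.1.totalDegree, fun S T hS hT hSD hTD => ?_⟩
  obtain ⟨P, hPD, hP⟩ := hS.exists_sign_family hSD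
  obtain ⟨Q, hQD, hQ⟩ := hT.exists_sign_family hTD
  let c : τ → ℝ := Sum.elim
    (fun t => (P t.1).coeff (Finsupp.equivFunOnFinite.symm fun i => (t.2 i : ℕ)))
    (fun t => (Q t.1).coeff (Finsupp.equivFunOnFinite.symm fun i => (t.2 i : ℕ)))
  have hcomp := isSemialgebraic_of_sign (fun g : G => specialize c g.1) (A := relComp S T) ?_
  · refine ⟨hcomp.1, hcomp.2.trans (Nat.mul_le_mul_left _ (Finset.sum_le_sum fun g _ => ?_))⟩
    exact totalDegree_specialize_le c g.1
  rintro z z' hz ⟨y, hy₁, hy₂⟩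
  simp only [eval_specialize] at hz
  obtain ⟨y', hy'⟩ := h _ _ (fun g hg => hz ⟨g, hg⟩) y
  refine ⟨y', hP _ _ (fun j => ?_) hy₁, hQ _ _ (fun j => ?_) hy₂⟩
  · have := hy' (U j) (Or.inl (Set.mem_range_self j))
    rwa [hU, hU, eval_universalPoly (hPD j), eval_universalPoly (hPD j)] at this
  · have := hy' (V j) (Or.inr (Set.mem_range_self j))
    rwa [hV, hV, eval_universalPoly (hQD j), eval_universalPoly (hQD j)] at this

theorem graphSet_comp {k m p : ℕ} {A : Set (Fin k → ℝ)} {B : Set (Fin m → ℝ)}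
    {ψ : (Fin k → ℝ) → (Fin m → ℝ)} {φ : (Fin m → ℝ) → (Fin p → ℝ)} (h : ∀ x ∈ A, ψ x ∈ B) :
    graphSet A (φ ∘ ψ) = relComp (graphSet A ψ) (graphSet B φ) := by
  ext z
  simp only [graphSet, relComp, Set.mem_ofPred_eq, Fin.append_left, Fin.append_right,
    Function.comp_apply]
  constructor
  · rintro ⟨hA, hz⟩
    exact ⟨_, ⟨hA, rfl⟩, h _ hA, hz⟩
  · rintro ⟨y, ⟨hA, hy⟩, -, hz⟩
    exact ⟨hA, hz.trans (congrArg φ hy)⟩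

end UniformDegree

/-- Composition of semi-algebraic maps is semi-algebraic, of degree bounded by a function
of the degrees of the two maps and the ambient dimensions only. -/
theorem comp_semialgebraic_maps :
    ∃ C : ℕ → ℕ → ℕ → ℕ → ℕ → ℕ,
      ∀ (k m p : ℕ) (A : Set (Fin k → ℝ)) (B : Set (Fin m → ℝ))
        (ψ : (Fin k → ℝ) → (Fin m → ℝ)) (φ : (Fin m → ℝ) → (Fin p → ℝ)),
        IsSAMap A ψ → IsSAMap B φ → (∀ x ∈ A, ψ x ∈ B) →
        IsSAMap A (φ ∘ ψ) ∧
        SAMapDeg A (φ ∘ ψ) ≤ C (SAMapDeg B φ) (SAMapDeg A ψ) k m p := by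
  choose N hN using exists_relComp_bound
  refine ⟨fun D₂ D₁ k m p => N D₁ D₂ k m p, fun k m p A B ψ φ hψ hφ h => ?_⟩
  rw [IsSAMap, SAMapDeg, graphSet_comp h]
  exact hN _ _ k m p _ _ hψ hφ le_rfl le_rfl
end
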